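/- arXiv:2303.06454 — 4 statements merged into one kernel-verified Lean document; each statement's English description precedes it below -/
import Mathlib

section
/- Let A be a finite module over 𝔒 = ℤ_p[X]/(g) with A ≅ ⊕_{i=1}^{s} 𝔒/𝔓^{n_i} as 𝔒-modules, and let λ = (n_1, …, n_s) be the associated partition. Then, as an abelian group, A ≅ ⊕_{i≥1} (ℤ/p^{i}ℤ)^{f_{p−1,i}(λ)}. -/
open DirectSum Polynomial

/-- `ℓ(λ_{e,l})`: the number of parts `n_j` of the partition `n : Fin s → ℕ`
with `(l-1)e < n_j ≤ le`. -/
def partLen (e l : ℕ) {s : ℕ} (n : Fin s → ℕ) : ℕ :=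
  (Finset.univ.filter (fun j : Fin s => (l - 1) * e < n j ∧ n j ≤ l * e)).card

/-- `w_{e,l}(λ) = Σ_{(l-1)e < n_j ≤ le} (n_j - (l-1)e)`, the weight of `λ` at `(e,l)`. -/
def partWeight (e l : ℕ) {s : ℕ} (n : Fin s → ℕ) : ℕ :=
  ∑ j : Fin s, if (l - 1) * e < n j ∧ n j ≤ l * e then n j - (l - 1) * e else 0

/-- `f_{e,l}(λ) = ℓ(λ_{e,l+1})·e − w_{e,l+1}(λ) + w_{e,l}(λ)`. -/
def fEL (e l : ℕ) {s : ℕ} (n : Fin s → ℕ) : ℕ :=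
  partLen e (l + 1) n * e - partWeight e (l + 1) n + partWeight e l n

/-- `⌈(n - i) / (d + 1)⌉`: the exponent of the uniformizer of the base in the `i`-th elementary
divisor of the `n`-th power of the maximal ideal of an Eisenstein extension of degree `d + 1`. -/
def ceilExp (d n i : ℕ) : ℕ := (n - i + d) / (d + 1)

theorem ceilExp_zero_left (d i : ℕ) : ceilExp d 0 i = 0 := by
  simp [ceilExp, Nat.div_eq_of_lt]

theorem ceilExp_succ_succ (d n i : ℕ) : ceilExp d (n + 1) (i + 1) = ceilExp d n i := by
  simp [ceilExp]

theorem ceilExp_succ_zero (d n : ℕ) : ceilExp d (n + 1) 0 = ceilExp d n d + 1 := by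
  unfold ceilExp
  rw [← Nat.add_div_right _ (Nat.succ_pos d)]
  rcases le_total d n with h | h
  · congr 1; omega
  · rw [Nat.sub_eq_zero_of_le h, Nat.div_eq_of_lt_le (k := 1), Nat.div_eq_of_lt_le (k := 1)] <;>
      omega

theorem ceilExp_le_ceilExp_zero (d n i : ℕ) : ceilExp d n i ≤ ceilExp d n 0 :=
  Nat.div_le_div_right (by omega)

theorem ceilExp_eq_iff {d n i l : ℕ} (hl : 1 ≤ l) :
    ceilExp d n i = l ↔ n - l * (d + 1) ≤ i ∧ i < n - (l - 1) * (d + 1) := by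
  obtain ⟨k, rfl⟩ : ∃ k, l = k + 1 := ⟨l - 1, by omega⟩
  simp only [Nat.add_sub_cancel]
  unfold ceilExp
  rw [Nat.div_eq_iff (Nat.succ_pos d)]
  have h : (k + 1) * (d + 1) = k * (d + 1) + (d + 1) := by ring
  rw [h]
  omega

theorem card_ceilExp_eq (d n l : ℕ) (hl : 1 ≤ l) :
    (Finset.univ.filter (fun i : Fin (d + 1) => ceilExp d n i = l)).card =
      (if l * (d + 1) < n ∧ n ≤ (l + 1) * (d + 1) then (d + 1) - (n - l * (d + 1)) else 0) +
      (if (l - 1) * (d + 1) < n ∧ n ≤ l * (d + 1) then n - (l - 1) * (d + 1) else 0) := by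
  have h1 : (Finset.univ.filter (fun i : Fin (d + 1) => ceilExp d n i = l)).card =
      (Finset.Ico (n - l * (d + 1)) (min (d + 1) (n - (l - 1) * (d + 1)))).card := by
    rw [← Finset.card_map Fin.valEmbedding]
    congr 1
    ext i
    simp only [Finset.mem_map, Finset.mem_filter, Finset.mem_univ, true_and, ceilExp_eq_iff hl,
      Fin.valEmbedding_apply, Finset.mem_Ico, lt_min_iff]
    constructor
    · rintro ⟨j, hj, rfl⟩
      exact ⟨hj.1, j.2, hj.2⟩
    · rintro ⟨h, h', h''⟩
      exact ⟨⟨i, h'⟩, ⟨h, h''⟩, rfl⟩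
  rw [h1, Nat.card_Ico]
  obtain ⟨k, rfl⟩ : ∃ k, l = k + 1 := ⟨l - 1, by omega⟩
  simp only [Nat.add_sub_cancel]
  have h2 : (k + 1) * (d + 1) = k * (d + 1) + (d + 1) := by ring
  have h3 : (k + 1 + 1) * (d + 1) = k * (d + 1) + (d + 1) + (d + 1) := by ring
  rw [h2, h3]
  generalize k * (d + 1) = m
  split_ifs <;> omega

theorem card_ceilExp_eq_fEL (d l : ℕ) (hl : 1 ≤ l) {s : ℕ} (n : Fin s → ℕ) :
    Fintype.card {x : Fin s × Fin (d + 1) // ceilExp d (n x.1) x.2 = l} = fEL (d + 1) l n := by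
  rw [Fintype.card_subtype, Finset.card_filter, Fintype.sum_prod_type]
  simp_rw [← Finset.card_filter, card_ceilExp_eq d _ l hl, Finset.sum_add_distrib]
  unfold fEL partLen partWeight
  congr 1
  rw [Finset.card_filter, Finset.sum_mul]
  symm
  apply Nat.sub_eq_of_eq_add
  rw [← Finset.sum_add_distrib]
  refine Finset.sum_congr rfl fun j _ => ?_
  have h2 : (l + 1) * (d + 1) = l * (d + 1) + (d + 1) := by ring
  rw [Nat.add_sub_cancel, h2]
  split_ifs <;> omega

section Eisenstein

variable {R S : Type*} [CommRing R] [CommRing S] [Algebra R S] {d : ℕ}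
  (b : Module.Basis (Fin (d + 1)) R S) {π : S} {ϖ : R} {a : Fin (d + 1) → R}

theorem gen_mul_eq_sum (hb : ∀ i, b i = π ^ (i : ℕ))
    (hrel : π ^ (d + 1) = -(ϖ • ∑ i, a i • π ^ (i : ℕ))) (c : Fin (d + 1) → R) :
    π * ∑ i, c i • b i = (-(ϖ * a 0 * c (Fin.last d))) • b 0 +
      ∑ i : Fin d, (c i.castSucc - ϖ * a i.succ * c (Fin.last d)) • b i.succ := by
  have h : π * ∑ i, c i • b i =
      ∑ i : Fin d, c i.castSucc • b i.succ + c (Fin.last d) • π ^ (d + 1) := by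
    rw [Fin.sum_univ_castSucc, mul_add, Finset.mul_sum]
    simp [hb, pow_succ']
  simp_rw [h, hrel, ← hb, Fin.sum_univ_succ, sub_smul, Finset.sum_sub_distrib, smul_neg, smul_add,
    Finset.smul_sum, smul_smul, neg_smul]
  have h' : ∀ i, c (Fin.last d) * (ϖ * a i) = ϖ * a i * c (Fin.last d) := fun i => mul_comm _ _
  simp_rw [h']
  abel

theorem mem_span_gen_pow_iff (hb : ∀ i, b i = π ^ (i : ℕ))
    (hrel : π ^ (d + 1) = -(ϖ • ∑ i, a i • π ^ (i : ℕ))) (ha : a 0 = 1) (n : ℕ) (y : S) :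
    y ∈ Ideal.span {π} ^ n ↔ ∀ i : Fin (d + 1), ϖ ^ ceilExp d n i ∣ b.repr y i := by
  rw [Ideal.span_singleton_pow, Ideal.mem_span_singleton]
  have hrepr : ∀ (u : R) (v : Fin d → R), b.repr (u • b 0 + ∑ i, v i • b i.succ) =
      Finsupp.equivFunOnFinite.symm (Fin.cons u v) := fun u v => by
    have : u • b 0 + ∑ i, v i • b i.succ = ∑ i, (Fin.cons u v : Fin (d + 1) → R) i • b i := by
      simp [Fin.sum_univ_succ]
    rw [this]
    ext i
    rw [b.repr_sum_self]
    rfl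
  induction n generalizing y with
  | zero => simp [ceilExp_zero_left]
  | succ n ih =>
    rw [Fin.forall_fin_succ]
    simp only [Fin.val_zero, Fin.val_succ, ceilExp_succ_succ, ceilExp_succ_zero]
    have hle : ∀ i : Fin d, ceilExp d n i ≤ ceilExp d n d + 1 := fun i => by
      rw [← ceilExp_succ_succ, ← ceilExp_succ_zero]
      exact ceilExp_le_ceilExp_zero ..
    constructor
    · rintro ⟨z, rfl⟩
      have hx := (ih (π ^ n * z)).1 (dvd_mul_right _ _)
      rw [pow_succ' π, mul_assoc, ← b.sum_repr (π ^ n * z), gen_mul_eq_sum b hb hrel, hrepr]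
      have hlast : ϖ ^ (ceilExp d n d + 1) ∣ ϖ * b.repr (π ^ n * z) (Fin.last d) := by
        rw [pow_succ']
        exact mul_dvd_mul_left _ (hx (Fin.last d))
      refine ⟨?_, fun i => ?_⟩
      · simpa [ha] using hlast
      · have h1 : ϖ ^ ceilExp d n i ∣ b.repr (π ^ n * z) i.castSucc := hx i.castSucc
        have h2 := ((pow_dvd_pow ϖ (hle i)).trans hlast).mul_left (a i.succ)
        simpa [mul_assoc, mul_left_comm] using dvd_sub h1 h2
    · rintro ⟨⟨t, ht⟩, hs⟩
      let u : R := -(ϖ ^ ceilExp d n d * t)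
      let v : Fin d → R := fun i => b.repr y i.succ + ϖ * a i.succ * u
      let c : Fin (d + 1) → R := Fin.snoc v u
      have hy : y = π * ∑ i, c i • b i := by
        rw [gen_mul_eq_sum b hb hrel]
        conv_lhs => rw [← b.sum_repr y, Fin.sum_univ_succ]
        congr 1
        · rw [ht, ha]
          simp only [c, Fin.snoc_last, u]
          congr 1
          ring
        · simp [c, v]
      rw [hy, pow_succ']
      refine mul_dvd_mul_left _ ((ih _).2 fun i => ?_)
      rw [b.repr_sum_self]
      induction i using Fin.lastCases with
      | last => simp [c, u]
      | cast i =>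
        have h2 : ϖ ^ (ceilExp d n d + 1) ∣ ϖ * u := by
          rw [pow_succ']
          exact mul_dvd_mul_left _ ((dvd_mul_right _ _).neg_right)
        have h3 := ((pow_dvd_pow ϖ (hle i)).trans h2).mul_left (a i.succ)
        simpa [c, v, mul_assoc, mul_left_comm] using dvd_add (hs i) h3

end Eisenstein

theorem nonempty_quotient_span_gen_pow_addEquiv {p : ℕ} [Fact p.Prime] {S : Type*} [CommRing S]
    [Algebra ℤ_[p] S] {d : ℕ} (b : Module.Basis (Fin (d + 1)) ℤ_[p] S) {π : S}
    {a : Fin (d + 1) → ℤ_[p]} (hb : ∀ i, b i = π ^ (i : ℕ))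
    (hrel : π ^ (d + 1) = -((p : ℤ_[p]) • ∑ i, a i • π ^ (i : ℕ))) (ha : a 0 = 1) (n : ℕ) :
    Nonempty ((S ⧸ Ideal.span {π} ^ n) ≃+ ∀ i : Fin (d + 1), ZMod (p ^ ceilExp d n i)) := by
  let ψ : S →+ ∀ i : Fin (d + 1), ZMod (p ^ ceilExp d n i) :=
    AddMonoidHom.mk' (fun x i => PadicInt.toZModPow (ceilExp d n i) (b.repr x i))
      fun x y => by ext i; simp
  have hψ : Function.Surjective ψ := fun f => by
    choose c hc using fun i => ZMod.ringHom_surjective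
      (PadicInt.toZModPow (p := p) (ceilExp d n (i : Fin (d + 1)))) (f i)
    refine ⟨∑ i, c i • b i, funext fun i => ?_⟩
    change PadicInt.toZModPow _ (b.repr _ i) = _
    rw [b.repr_sum_self, hc]
  have hker : (Ideal.span {π} ^ n).toAddSubgroup = ψ.ker := by
    ext x
    rw [AddMonoidHom.mem_ker, funext_iff, Submodule.mem_toAddSubgroup,
      mem_span_gen_pow_iff b hb hrel ha]
    refine forall_congr' fun i => ?_
    change _ ↔ PadicInt.toZModPow _ _ = 0
    rw [← RingHom.mem_ker, PadicInt.ker_toZModPow, Ideal.mem_span_singleton]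
  exact ⟨(QuotientAddGroup.quotientAddEquivOfEq hker).trans
    (QuotientAddGroup.quotientKerEquivOfSurjective ψ hψ)⟩

theorem nonempty_pi_zmod_pow_addEquiv_directSum {ι : Type*} [Fintype ι] (p : ℕ) (c : ι → ℕ)
    (f : ℕ → ℕ) (hf : ∀ k, Fintype.card {x // c x = k + 1} = f k) :
    Nonempty ((∀ x, ZMod (p ^ c x)) ≃+ ⨁ k : ℕ, (Fin (f k) → ZMod (p ^ (k + 1)))) := by
  classical
  let r : (∀ x, ZMod (p ^ c x)) →+ ∀ x : {x // 1 ≤ c x}, ZMod (p ^ c x) :=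
    AddMonoidHom.mk' (fun g x => g x) fun _ _ => rfl
  have hr : Function.Bijective r := by
    constructor
    · intro g h hgh
      ext x
      by_cases hx : 1 ≤ c x
      · exact congrFun hgh ⟨x, hx⟩
      · have h0 : p ^ c x = 1 := by simp [show c x = 0 by omega]
        have : Subsingleton (ZMod (p ^ c x)) := by rw [h0]; infer_instance
        exact Subsingleton.elim _ _
    · intro g
      exact ⟨fun x => if hx : 1 ≤ c x then g ⟨x, hx⟩ else 0, funext fun x => dif_pos x.2⟩
  let E : {x // 1 ≤ c x} ≃ Σ k : ℕ, {x // c x = k + 1} :=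
    { toFun := fun x => ⟨c x - 1, x, (Nat.sub_add_cancel x.2).symm⟩
      invFun := fun y => ⟨y.2, by have := y.2.2; omega⟩
      left_inv := fun x => rfl
      right_inv := by
        rintro ⟨k, x, hx⟩
        obtain rfl : k = c x - 1 := by omega
        rfl }
  let e : ∀ k, {x // c x = k + 1} ≃ Fin (f k) := fun k => Fintype.equivFinOfCardEq (hf k)
  let E' : (Σ k : ℕ, Fin (f k)) ≃ {x // 1 ≤ c x} := ((Equiv.sigmaCongrRight e).symm).trans E.symm
  have hE : ∀ y, c (E' y) = y.1 + 1 := fun y => ((e y.1).symm y.2).2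
  let T₁ : (∀ x : {x // 1 ≤ c x}, ZMod (p ^ c x)) ≃+ ⨁ x : {x // 1 ≤ c x}, ZMod (p ^ c x) :=
    (DirectSum.addEquivProd _).symm
  let T₂ : (⨁ x : {x // 1 ≤ c x}, ZMod (p ^ c x)) ≃+
      ⨁ y : Σ k : ℕ, Fin (f k), ZMod (p ^ c (E' y)) :=
    DirectSum.equivCongrLeft E'.symm
  let T₃ : (⨁ y : Σ k : ℕ, Fin (f k), ZMod (p ^ c (E' y))) ≃+
      ⨁ y : Σ k : ℕ, Fin (f k), ZMod (p ^ (y.1 + 1)) :=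
    DFinsupp.mapRange.addEquiv fun y => (ZMod.ringEquivCongr (by rw [hE])).toAddEquiv
  let T₄ : (⨁ y : Σ k : ℕ, Fin (f k), ZMod (p ^ (y.1 + 1))) ≃+
      ⨁ k : ℕ, ⨁ _ : Fin (f k), ZMod (p ^ (k + 1)) :=
    DirectSum.sigmaCurryEquiv (δ := fun k (_ : Fin (f k)) => ZMod (p ^ (k + 1)))
  let T₅ : (⨁ k : ℕ, ⨁ _ : Fin (f k), ZMod (p ^ (k + 1))) ≃+
      ⨁ k : ℕ, (Fin (f k) → ZMod (p ^ (k + 1))) :=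
    DFinsupp.mapRange.addEquiv fun k => DirectSum.addEquivProd _
  exact ⟨(AddEquiv.ofBijective r hr).trans <| T₁.trans <| T₂.trans <| T₃.trans <| T₄.trans T₅⟩

theorem sum_choose_mul_X_pow_eq {p d : ℕ} [Fact p.Prime] (hd : p = d + 2) :
    ∑ i ∈ Finset.Icc 1 p, C (p.choose i : ℤ_[p]) * X ^ (i - 1) =
      X ^ (d + 1) + C (p : ℤ_[p]) *
        ∑ i : Fin (d + 1), C ((p.choose (i + 1) / p : ℕ) : ℤ_[p]) * X ^ (i : ℕ) := by
  have h : ∑ i ∈ Finset.Icc 1 p, C (p.choose i : ℤ_[p]) * X ^ (i - 1) =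
      ∑ i ∈ Finset.range (d + 2), C (p.choose (i + 1) : ℤ_[p]) * X ^ i := by
    have h' := Finset.sum_Ico_add' (fun i => C (p.choose i : ℤ_[p]) * X ^ (i - 1)) 0 (d + 2) 1
    simp only [Nat.add_sub_cancel, zero_add, Finset.Ico_add_one_right_eq_Icc, ← hd] at h'
    rw [← h', Finset.range_eq_Ico, ← hd]
  rw [h, Finset.sum_range_succ, add_comm, Finset.sum_range, Finset.mul_sum]
  congr 1
  · simp [← hd]
  · refine Finset.sum_congr rfl fun i _ => ?_
    have hdvd : p ∣ p.choose (i + 1) :=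
      (Fact.out : p.Prime).dvd_choose_self (by omega) (by omega)
    conv_lhs => rw [← Nat.mul_div_cancel' hdvd]
    rw [Nat.cast_mul, C_mul, mul_assoc]

/-- Let `𝔒 = ℤ_p[X]/(g)` where `g = Σ_{i=1}^p C(p,i) X^(i-1)`,
a discrete valuation ring with maximal ideal `𝔓 = (π)`, `π` the image of `X`.
If `A` is a finite `𝔒`-module with `A ≅ ⊕_{i=1}^s 𝔒/𝔓^(n_i)` and
`λ = (n_1 ≥ … ≥ n_s)`, then as an abelian group
`A ≅ ⊕_{i ≥ 1} (ℤ/p^iℤ)^(f_{p-1,i}(λ))`. -/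
theorem stmt_3 (p : ℕ) [Fact p.Prime]
    (g : ℤ_[p][X]) (hg : g = ∑ i ∈ Finset.Icc 1 p, C (p.choose i : ℤ_[p]) * X ^ (i - 1))
    (A : Type) [AddCommGroup A] [Finite A]
    [Module (ℤ_[p][X] ⧸ Ideal.span {g}) A]
    (s : ℕ) (n : Fin s → ℕ) (hanti : Antitone n) (hpos : ∀ i, 1 ≤ n i)
    (hiso : Nonempty (A ≃ₗ[ℤ_[p][X] ⧸ Ideal.span {g}]
      ⨁ i : Fin s, (ℤ_[p][X] ⧸ Ideal.span {g}) ⧸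
        (Ideal.span {Ideal.Quotient.mk (Ideal.span {g}) X}) ^ (n i))) :
    Nonempty (A ≃+ ⨁ i : ℕ, (Fin (fEL (p - 1) (i + 1) n) → ZMod (p ^ (i + 1)))) := by
  obtain ⟨d, hd⟩ : ∃ d, p = d + 2 :=
    ⟨p - 2, (Nat.sub_add_cancel (Fact.out : p.Prime).two_le).symm⟩
  rw [sum_choose_mul_X_pow_eq hd, Finset.mul_sum] at hg
  have hlt : (∑ i : Fin (d + 1), C (p : ℤ_[p]) *
      (C ((p.choose (i + 1) / p : ℕ) : ℤ_[p]) * X ^ (i : ℕ))).degree < ((d + 1 : ℕ) : WithBot ℕ) := by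
    refine (degree_sum_le _ _).trans_lt ((Finset.sup_lt_iff (WithBot.bot_lt_coe _)).2 fun i _ => ?_)
    rw [← mul_assoc, ← C_mul]
    exact (degree_C_mul_X_pow_le _ _).trans_lt (by exact_mod_cast i.2)
  have hmonic : g.Monic := hg ▸ monic_X_pow_add hlt
  have hdeg : g.natDegree = d + 1 := by
    rw [hg, natDegree_eq_of_degree_eq_some]
    rw [degree_add_eq_left_of_degree_lt (by rwa [degree_X_pow]), degree_X_pow]
  let B := AdjoinRoot.powerBasis' hmonic
  let b : Module.Basis (Fin (d + 1)) ℤ_[p] (AdjoinRoot g) := B.basis.reindex (finCongr hdeg)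
  have hb : ∀ i, b i = AdjoinRoot.root g ^ (i : ℕ) := fun i => by
    simp [b, B]
    rfl
  have hrel : AdjoinRoot.root g ^ (d + 1) = -((p : ℤ_[p]) • ∑ i : Fin (d + 1),
      ((p.choose (i + 1) / p : ℕ) : ℤ_[p]) • AdjoinRoot.root g ^ (i : ℕ)) := by
    have h : aeval (AdjoinRoot.root g) g = 0 := by simp
    replace h := (congrArg (aeval (AdjoinRoot.root g)) hg).symm.trans h
    rw [← Finset.mul_sum] at h
    simpa [eq_neg_iff_add_eq_zero, Algebra.smul_def] using h
  have ha : ((p.choose ((0 : Fin (d + 1)) + 1) / p : ℕ) : ℤ_[p]) = 1 := by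
    simp [Nat.div_self (Fact.out : p.Prime).pos]
  have φ := fun j => (nonempty_quotient_span_gen_pow_addEquiv b hb hrel ha (n j)).some
  obtain ⟨ε⟩ := hiso
  obtain ⟨χ⟩ := nonempty_pi_zmod_pow_addEquiv_directSum p
    (fun x : Fin s × Fin (d + 1) => ceilExp d (n x.1) x.2) (fun k => fEL (p - 1) (k + 1) n)
    (fun k => by rw [card_ceilExp_eq_fEL d _ (by omega)]; simp [hd])
  let Φ : A ≃+ ∀ j, (AdjoinRoot g ⧸ Ideal.span {AdjoinRoot.root g} ^ n j) :=
    ε.toAddEquiv.trans (DirectSum.addEquivProd _)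
  let curry : (∀ x : Fin s × Fin (d + 1), ZMod (p ^ ceilExp d (n x.1) x.2)) ≃+
      ∀ (j : Fin s) (i : Fin (d + 1)), ZMod (p ^ ceilExp d (n j) i) :=
    { toFun := fun f j i => f (j, i)
      invFun := fun f x => f x.1 x.2
      left_inv := fun _ => rfl
      right_inv := fun _ => rfl
      map_add' := fun _ _ => rfl }
  exact ⟨Φ.trans <| (AddEquiv.piCongrRight φ).trans <| curry.symm.trans χ⟩
end

section
/- Let G be a finite non-abelian p-group such that the center Z(Φ(G)) of the Frattini subgroup Φ(G) of G can be generated by p−2 elements. Then G has an automorphism φ of order p which is not inner and which fixes Φ(G) element-wise (φ(g) = g for all g ∈ Φ(G)). -/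
section Frattini

variable {p : ℕ} [Fact p.Prime] {G : Type*} [Group G]

theorem pow_val_add {x : G} (hx : x ^ p = 1) (k l : ZMod p) :
    x ^ (k + l).val = x ^ k.val * x ^ l.val := by
  rw [ZMod.val_add, ← pow_eq_pow_mod _ hx, pow_add]

theorem pow_val_mul {x : G} (hx : x ^ p = 1) (k l : ZMod p) :
    x ^ (k * l).val = x ^ (k.val * l.val) := by
  rw [ZMod.val_mul, ← pow_eq_pow_mod _ hx]

theorem pow_val_eq_one_iff {x : G} (hx : x ^ p = 1) (hx1 : x ≠ 1) {k : ZMod p} :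
    x ^ k.val = 1 ↔ k = 0 := by
  have ho := orderOf_eq_prime hx hx1
  constructor
  · intro h
    have h1 := orderOf_dvd_of_pow_eq_one h
    rw [ho] at h1
    have h2 := Nat.eq_zero_of_dvd_of_lt h1 (ZMod.val_lt k)
    simpa using h2
  · rintro rfl
    simp

theorem isCoatom_ker_of_ne_one {κ : G →* Multiplicative (ZMod p)} (hκ : κ ≠ 1) :
    IsCoatom κ.ker := by
  refine ⟨fun h => hκ (MonoidHom.ker_eq_top_iff.1 h), fun K hK => ?_⟩
  obtain ⟨a, haK, ha⟩ := SetLike.exists_of_lt hK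
  have hcard : Nat.card (Multiplicative (ZMod p)) = p := by simp
  refine eq_top_iff.2 fun g _ => ?_
  have ha1 : κ a ≠ 1 := ha
  obtain ⟨n, hn⟩ := mem_zpowers_of_prime_card hcard ha1 (g' := κ g)
  have : g * (a ^ n)⁻¹ ∈ κ.ker := by
    rw [MonoidHom.mem_ker, map_mul, map_inv, map_zpow]
    simp only at hn
    rw [hn, mul_inv_cancel]
  have h2 := K.mul_mem (hK.le this) (K.zpow_mem haK n)
  simpa using h2

theorem map_eq_one_of_mem_frattini (κ : G →* Multiplicative (ZMod p)) {g : G}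
    (hg : g ∈ frattini G) : κ g = 1 := by
  by_cases hκ : κ = 1
  · simp [hκ]
  · exact frattini_le_coatom (isCoatom_ker_of_ne_one hκ) hg

theorem IsPGroup.card_quotient_of_isCoatom [Finite G] (hG : IsPGroup p G) {M : Subgroup G}
    [M.Normal] (hM : IsCoatom M) : Nat.card (G ⧸ M) = p := by
  have hnt : Nontrivial (G ⧸ M) := QuotientGroup.nontrivial_iff.2 hM.1
  have hdvd : p ∣ Nat.card (G ⧸ M) := by
    obtain ⟨n, hn, h⟩ := (hG.to_quotient M).nontrivial_iff_card.1 hnt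
    rw [h]
    exact dvd_pow_self p hn.ne'
  obtain ⟨x, hx⟩ := exists_prime_orderOf_dvd_card' p hdvd
  have hlt : M < (Subgroup.zpowers x).comap (QuotientGroup.mk' M) := by
    refine lt_of_le_of_ne (fun m hm => ?_) fun h => ?_
    · have : QuotientGroup.mk' M m = 1 := (QuotientGroup.eq_one_iff m).2 hm
      rw [Subgroup.mem_comap, this]
      exact one_mem _
    · obtain ⟨y, rfl⟩ := QuotientGroup.mk'_surjective M x
      have hy : y ∈ M := by
        rw [h]
        exact Subgroup.mem_zpowers _
      rw [QuotientGroup.mk'_apply, (QuotientGroup.eq_one_iff y).2 hy, orderOf_one] at hx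
      exact (Fact.out : p.Prime).one_lt.ne hx
  have htop := hM.2 _ hlt
  have : Subgroup.zpowers x = ⊤ := by
    rw [← Subgroup.map_comap_eq_self_of_surjective (QuotientGroup.mk'_surjective M)
      (Subgroup.zpowers x), htop, Subgroup.map_top_of_surjective _
      (QuotientGroup.mk'_surjective M)]
  rw [← Subgroup.card_top (G := G ⧸ M), ← this, Nat.card_zpowers, hx]

theorem IsPGroup.exists_hom_ne_one [Finite G] (hG : IsPGroup p G) {c : G}
    (hc : c ∉ frattini G) : ∃ κ : G →* Multiplicative (ZMod p), κ c ≠ 1 := by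
  have : ∃ M : Subgroup G, IsCoatom M ∧ c ∉ M := by
    simpa [frattini, Order.radical, Subgroup.mem_iInf] using hc
  obtain ⟨M, hM, hcM⟩ := this
  have := hG.isNilpotent
  have hn : M.Normal :=
    Subgroup.NormalizerCondition.normal_of_coatom M Group.normalizerCondition_of_isNilpotent hM
  have hcard : Nat.card (Multiplicative (ZMod p)) = p := by simp
  let e := mulEquivOfPrimeCardEq (hG.card_quotient_of_isCoatom hM) hcard
  refine ⟨e.toMonoidHom.comp (QuotientGroup.mk' M), fun h => hcM ?_⟩
  have h1 : e (QuotientGroup.mk' M c) = 1 := h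
  exact (QuotientGroup.eq_one_iff c).1 ((MulEquiv.map_eq_one_iff e).1 h1)

theorem IsPGroup.mem_frattini_iff [Finite G] (hG : IsPGroup p G) {g : G} :
    g ∈ frattini G ↔ ∀ κ : G →* Multiplicative (ZMod p), κ g = 1 := by
  refine ⟨fun h κ => map_eq_one_of_mem_frattini κ h, fun h => ?_⟩
  by_contra hg
  obtain ⟨κ, hκ⟩ := hG.exists_hom_ne_one hg
  exact hκ (h κ)

theorem IsPGroup.pow_mem_frattini [Finite G] (hG : IsPGroup p G) (g : G) :
    g ^ p ∈ frattini G := by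
  refine hG.mem_frattini_iff.2 fun κ => ?_
  rw [map_pow]
  refine Multiplicative.toAdd.injective ?_
  simp

theorem IsPGroup.mul_mul_inv_mul_inv_mem_frattini [Finite G] (hG : IsPGroup p G) (g h : G) :
    g * h * g⁻¹ * h⁻¹ ∈ frattini G := by
  refine hG.mem_frattini_iff.2 fun κ => ?_
  simp only [map_mul, map_inv]
  rw [mul_right_comm]
  simp

/-- A nontrivial normal subgroup of a finite `p`-group contains a central element of order `p`. -/
theorem IsPGroup.exists_mem_center_of_normal [Finite G] (hG : IsPGroup p G) {N : Subgroup G}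
    [N.Normal] (hN : N ≠ ⊥) : ∃ z ∈ N, z ∈ Subgroup.center G ∧ z ^ p = 1 ∧ z ≠ 1 := by
  have hnt : Nontrivial N := (Subgroup.nontrivial_iff_ne_bot N).2 hN
  obtain ⟨n, hn, hcard⟩ := (hG.to_subgroup N).nontrivial_iff_card.1 hnt
  have hG' : IsPGroup p (ConjAct G) := hG
  obtain ⟨b, hb, hb1⟩ := hG'.exists_fixed_point_of_prime_dvd_card_of_fixed_point N
    (hcard ▸ dvd_pow_self p hn.ne') (a := 1) (fun g => by simp)
  have hbc : (b : G) ∈ Subgroup.center G := by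
    refine Subgroup.mem_center_iff.2 fun g => ?_
    have := congrArg Subtype.val (hb (ConjAct.toConjAct g))
    rw [ConjAct.Subgroup.val_conj_smul, ConjAct.smul_def, ConjAct.ofConjAct_toConjAct] at this
    exact mul_inv_eq_iff_eq_mul.1 this
  obtain ⟨m, hm⟩ := IsPGroup.iff_orderOf.1 hG (b : G)
  have hm0 : m ≠ 0 := by
    rintro rfl
    rw [pow_zero, orderOf_eq_one_iff] at hm
    exact hb1 (Subtype.ext hm.symm)
  have ho : orderOf ((b : G) ^ p ^ (m - 1)) = p := by
    rw [orderOf_pow_of_dvd (pow_ne_zero _ (Fact.out : p.Prime).ne_zero)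
      (hm ▸ pow_dvd_pow p (Nat.sub_le m 1)), hm, Nat.pow_div (Nat.sub_le m 1)
      (Fact.out : p.Prime).pos, Nat.sub_sub_self (Nat.one_le_iff_ne_zero.2 hm0), pow_one]
  refine ⟨(b : G) ^ p ^ (m - 1), pow_mem b.2 _, pow_mem hbc _, ?_, fun h => ?_⟩
  · rw [← orderOf_dvd_iff_pow_eq_one, ho]
  · rw [h, orderOf_one] at ho
    exact (Fact.out : p.Prime).one_lt.ne ho

end Frattini

section Automorphisms

variable {p : ℕ} [Fact p.Prime] {G : Type*} [Group G]

theorem exists_mulAut_orderOf_eq [Finite G] (φ : G →* G) (δ : G → G)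
    (hφ : ∀ g, φ g = g * δ g) (hδ : ∀ g, φ (δ g) = δ g) (hp : ∀ g, δ g ^ p = 1)
    (hne : ∃ g, δ g ≠ 1) : ∃ ψ : MulAut G, orderOf ψ = p ∧ ∀ g, ψ g = φ g := by
  have hinj : Function.Injective φ := by
    refine (injective_iff_map_eq_one φ).2 fun g hg => ?_
    have h1 : δ g = g⁻¹ := by
      rw [hφ] at hg
      exact eq_inv_of_mul_eq_one_right hg
    have h2 := hδ g
    rwa [h1, map_inv, hg, inv_one, eq_comm, inv_eq_one] at h2
  let ψ : MulAut G := MulEquiv.ofBijective φ (Finite.injective_iff_bijective.1 hinj)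
  have hψ : ∀ g, ψ g = φ g := fun g => rfl
  have hpow : ∀ (n : ℕ) g, (ψ ^ n) g = g * δ g ^ n := by
    intro n
    induction n with
    | zero => simp
    | succ n ih =>
      intro g
      rw [pow_succ', MulAut.mul_apply, ih, hψ, map_mul, map_pow, hδ, hφ, pow_succ', mul_assoc]
  refine ⟨ψ, orderOf_eq_prime (MulEquiv.ext fun g => ?_) fun h => ?_, hψ⟩
  · rw [hpow, hp, mul_one, MulAut.one_apply]
  · obtain ⟨g, hg⟩ := hne
    have := hpow 1 g
    rw [pow_one, h, MulAut.one_apply, pow_one] at this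
    exact hg (left_eq_mul.1 this)

/-- Every automorphism of order `p` fixing the Frattini subgroup element-wise is inner. -/
def FrattiniFixersInner (p : ℕ) (G : Type*) [Group G] : Prop :=
  ∀ φ : MulAut G, orderOf φ = p → (∀ g ∈ frattini G, φ g = g) → ∃ h : G, ∀ g, φ g = h * g * h⁻¹

theorem FrattiniFixersInner.exists_centralizer [Finite G] (hG : FrattiniFixersInner p G)
    {δ : G → G} (hmul : ∀ g h, δ (g * h) = h⁻¹ * δ g * h * δ h)
    (hmem : ∀ g, δ g ∈ frattini G) (hfix : ∀ g ∈ frattini G, δ g = 1) (hp : ∀ g, δ g ^ p = 1) :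
    ∃ x ∈ Subgroup.centralizer (frattini G : Set G), ∀ g, x * g * x⁻¹ = g * δ g := by
  by_cases hne : ∃ g, δ g ≠ 1
  · let φ : G →* G := MonoidHom.mk' (fun g => g * δ g) fun g h => by
      simp only [hmul]
      group
    have hφ : ∀ g, φ g = g * δ g := fun g => rfl
    have hφ' : ∀ g ∈ frattini G, φ g = g := fun g hg => by rw [hφ, hfix g hg, mul_one]
    obtain ⟨ψ, hψ, hψφ⟩ := exists_mulAut_orderOf_eq φ δ hφ (fun g => hφ' _ (hmem g)) hp hne
    obtain ⟨x, hx⟩ := hG ψ hψ fun g hg => (hψφ g).trans (hφ' g hg)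
    refine ⟨x, Subgroup.mem_centralizer_iff.2 fun g hg => ?_, fun g => ?_⟩
    · have := hx g
      rw [hψφ, hφ' g hg] at this
      exact eq_mul_inv_iff_mul_eq.1 this
    · rw [← hx, hψφ, hφ]
  · push Not at hne
    exact ⟨1, one_mem _, fun g => by simp [hne]⟩

theorem FrattiniFixersInner.exists_centralizer_of_hom [Finite G] (hG : FrattiniFixersInner p G)
    (κ : G →* Multiplicative (ZMod p)) {z : G} (hz : z ∈ frattini G)
    (hzc : z ∈ Subgroup.center G) (hzp : z ^ p = 1) :
    ∃ x ∈ Subgroup.centralizer (frattini G : Set G),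
      ∀ g, x * g * x⁻¹ = g * z ^ (κ g).toAdd.val := by
  refine hG.exists_centralizer (fun g h => ?_) (fun g => pow_mem hz _) (fun g hg => ?_) fun g => ?_
  · have hc := Subgroup.mem_center_iff.1 (pow_mem hzc (κ g).toAdd.val) h
    rw [map_mul, toAdd_mul, pow_val_add hzp, mul_assoc h⁻¹, ← hc, inv_mul_cancel_left]
  · simp [map_eq_one_of_mem_frattini κ hg]
  · rw [← pow_mul, mul_comm, pow_mul, hzp, one_pow]

theorem FrattiniFixersInner.mem_frattini_of_conj [Finite G] (hG : IsPGroup p G) (hp2 : p ≠ 2)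
    (hI : FrattiniFixersInner p G) {κ : G →* Multiplicative (ZMod p)} (hκ : κ ≠ 1) {u z : G}
    (hz : z ∈ frattini G) (hzc : z ∈ Subgroup.center G) (hzp : z ^ p = 1) (hup : u ^ p = 1)
    (hκu : κ u = 1) (hu : ∀ g, u * g = g * u * z ^ (κ g).toAdd.val) : u ∈ frattini G := by
  by_contra hu1
  obtain ⟨κ', hκ'⟩ := hG.exists_hom_ne_one hu1
  have h2 : (2 : ZMod p) ≠ 0 := by
    have : ((2 : ℕ) : ZMod p) ≠ 0 := by
      rw [Ne, ZMod.natCast_eq_zero_iff]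
      exact fun h => hp2 ((Nat.prime_dvd_prime_iff_eq Fact.out Nat.prime_two).1 h)
    simpa using this
  let b : ZMod p → ZMod p := fun k => k * (k - 1) / 2
  have hb : ∀ k l, b (k + l) = b k + b l + k * l := fun k l => by
    simp only [b]
    field_simp
    ring
  have hb0 : b 0 = 0 := by simp [b]
  let δ : G → G := fun g => u ^ (κ g).toAdd.val * z ^ (b (κ g).toAdd).val
  have hzn : ∀ (n : ℕ) g, z ^ n * g = g * z ^ n := fun n g =>
    (Subgroup.mem_center_iff.1 (pow_mem hzc n) g).symm
  have hun : ∀ (n : ℕ) g, u ^ n * g = g * u ^ n * z ^ (n * (κ g).toAdd.val) := by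
    intro n g
    induction n with
    | zero => simp
    | succ n ih =>
      rw [pow_succ', mul_assoc, ih, ← mul_assoc, ← mul_assoc, hu, mul_assoc (g * u), hzn,
        add_mul, one_mul, add_comm, pow_add]
      simp only [mul_assoc]
  have hκz : κ z = 1 := map_eq_one_of_mem_frattini κ hz
  let φ : G →* G := MonoidHom.mk' (fun g => g * δ g) fun g h => by
    simp only [δ, map_mul, toAdd_mul, hb, pow_val_add hup, pow_val_add hzp, pow_val_mul hzp]
    have hB := hzn (b (κ g).toAdd).val
    have hC := hzn ((κ g).toAdd.val * (κ h).toAdd.val)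
    have hU := hun (κ g).toAdd.val h
    generalize u ^ (κ g).toAdd.val = U at *
    generalize u ^ (κ h).toAdd.val = W at *
    generalize z ^ (b (κ g).toAdd).val = B at *
    generalize z ^ (b (κ h).toAdd).val = B' at *
    generalize z ^ ((κ g).toAdd.val * (κ h).toAdd.val) = C at *
    calc g * h * (U * W * (B * B' * C)) = g * h * U * W * (B * B' * C) := by
          simp only [mul_assoc]
      _ = g * h * U * W * (C * (B * B')) := by rw [hC]
      _ = g * h * U * (W * C) * B * B' := by simp only [mul_assoc]
      _ = g * (h * U * C) * (W * B) * B' := by rw [← hC]; simp only [mul_assoc]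
      _ = g * U * (h * W * B) * B' := by rw [← hU]; simp only [mul_assoc]
      _ = g * U * (B * (h * W)) * B' := by rw [hB]
      _ = g * (U * B) * (h * (W * B')) := by simp only [mul_assoc]
  have hφ : ∀ g, φ g = g * δ g := fun g => rfl
  have hφ1 : ∀ g, κ g = 1 → φ g = g := fun g hg => by simp [hφ, δ, hg, hb0]
  have hδp : ∀ g, δ g ^ p = 1 := fun g => by
    have hc : Commute (u ^ (κ g).toAdd.val) (z ^ (b (κ g).toAdd).val) := (hzn _ _).symm
    rw [hc.mul_pow, ← pow_mul, ← pow_mul, mul_comm _ p, mul_comm _ p, pow_mul, pow_mul, hup, hzp]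
    simp
  have key : ∀ g, κ g ≠ 1 → κ' (δ g) ≠ 1 := by
    intro g hg h
    rw [map_mul, map_pow, map_pow, map_eq_one_of_mem_frattini κ' hz, one_pow, mul_one] at h
    have h3 : (κ' u) ^ p = 1 := by rw [← map_pow, hup, map_one]
    exact hg ((pow_val_eq_one_iff h3 hκ').1 h)
  obtain ⟨g, hg⟩ : ∃ g, κ g ≠ 1 := by
    by_contra! h
    exact hκ (MonoidHom.ext h)
  obtain ⟨ψ, hψ, hψφ⟩ := exists_mulAut_orderOf_eq φ δ hφ
    (fun g => hφ1 _ (by simp [δ, hκu, hκz])) hδp ⟨g, fun h => key g hg (by rw [h, map_one])⟩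
  obtain ⟨x, hx⟩ := hI ψ hψ fun g hg => (hψφ g).trans (hφ1 g (map_eq_one_of_mem_frattini κ hg))
  refine key g hg ?_
  have h := congrArg κ' (hx g)
  rw [hψφ, hφ, map_mul, map_mul κ' (x * g), map_mul κ' x, map_inv, mul_inv_cancel_comm] at h
  exact mul_eq_left.1 h

theorem mul_pow_of_conj {x y c : G} (hc : c ∈ Subgroup.center G) (h : y * x = x * y * c) (n : ℕ) :
    (x * y) ^ n = x ^ n * y ^ n * c ^ n.choose 2 := by
  have hcn : ∀ (n : ℕ) g, c ^ n * g = g * c ^ n := fun n g =>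
    (Subgroup.mem_center_iff.1 (pow_mem hc n) g).symm
  have hy : ∀ n : ℕ, y ^ n * x = x * y ^ n * c ^ n := by
    intro n
    induction n with
    | zero => simp
    | succ n ih =>
      rw [pow_succ', mul_assoc, ih, ← mul_assoc, ← mul_assoc, h, mul_assoc (x * y),
        ← pow_one c, hcn 1, pow_one, pow_succ' c]
      simp only [mul_assoc]
  induction n with
  | zero => simp
  | succ n ih =>
    calc (x * y) ^ (n + 1) = x ^ n * y ^ n * (c ^ n.choose 2 * (x * y)) := by
          rw [pow_succ, ih, mul_assoc]
      _ = x ^ n * (y ^ n * x) * y * c ^ n.choose 2 := by rw [hcn]; simp only [mul_assoc]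
      _ = x ^ n * x * y ^ n * (c ^ n * y) * c ^ n.choose 2 := by rw [hy]; simp only [mul_assoc]
      _ = x ^ (n + 1) * y ^ (n + 1) * c ^ (n + 1).choose 2 := by
        rw [hcn, Nat.choose_succ_succ, Nat.choose_one_right, pow_add c n, pow_succ x, pow_succ y]
        simp only [mul_assoc]

end Automorphisms

section Centralizer

variable {p : ℕ} [Fact p.Prime] {G : Type*} [Group G]

theorem CommGroup.index_range_powMonoidHom {A : Type*} [CommGroup A] [Finite A] (n : ℕ) :
    (powMonoidHom n : A →* A).range.index = Nat.card (powMonoidHom n : A →* A).ker := by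
  have h1 := Subgroup.card_mul_index (powMonoidHom n : A →* A).range
  have h2 := Subgroup.card_mul_index (powMonoidHom n : A →* A).ker
  rw [Subgroup.index_ker, ← h1, mul_comm] at h2
  exact (Nat.eq_of_mul_eq_mul_left Nat.card_pos h2).symm

theorem FrattiniFixersInner.center_le [Finite G] (hG : IsPGroup p G)
    (hI : FrattiniFixersInner p G) (hΦ : frattini G ≠ ⊥) :
    Subgroup.center G ≤ frattini G := by
  intro t ht
  by_contra htΦ
  obtain ⟨z, hz, hzc, hzp, hz1⟩ := hG.exists_mem_center_of_normal hΦ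
  obtain ⟨κ, hκ⟩ := hG.exists_hom_ne_one htΦ
  obtain ⟨x, -, hx⟩ := hI.exists_centralizer_of_hom κ hz hzc hzp
  have := hx t
  rw [Subgroup.mem_center_iff.1 ht x, mul_inv_cancel_right, left_eq_mul,
    pow_val_eq_one_iff hzp hz1] at this
  exact hκ this

theorem conj_pow_eq {κ : G →* Multiplicative (ZMod p)} {x z : G} (hzp : z ^ p = 1)
    (hκz : κ z = 1) (hx : ∀ g, x * g * x⁻¹ = g * z ^ (κ g).toAdd.val) (n : ℕ) (g : G) :
    x ^ n * g * (x ^ n)⁻¹ = g * z ^ ((κ ^ n) g).toAdd.val := by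
  induction n with
  | zero => simp
  | succ n ih =>
    have : x ^ (n + 1) * g * (x ^ (n + 1))⁻¹ = x * (x ^ n * g * (x ^ n)⁻¹) * x⁻¹ := by
      rw [pow_succ']; group
    rw [this, ih, hx, map_mul, map_pow, hκz, one_pow, mul_one, mul_assoc, pow_succ,
      MonoidHom.mul_apply, toAdd_mul, pow_val_add hzp]

theorem pow_mem_center_of_conj {κ : G →* Multiplicative (ZMod p)} {x z : G} (hzp : z ^ p = 1)
    (hκz : κ z = 1) (hx : ∀ g, x * g * x⁻¹ = g * z ^ (κ g).toAdd.val) :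
    x ^ p ∈ Subgroup.center G := by
  refine Subgroup.mem_center_iff.2 fun g => ?_
  have h := conj_pow_eq hzp hκz hx p g
  have h0 : ((κ ^ p) g).toAdd = 0 := by
    rw [MonoidHom.pow_apply, toAdd_pow]
    simp
  rw [h0, ZMod.val_zero, pow_zero, mul_one] at h
  exact (mul_inv_eq_iff_eq_mul.1 h).symm

theorem FrattiniFixersInner.pow_ne_of_conj [Finite G] (hG : IsPGroup p G) (hp2 : p ≠ 2)
    (hI : FrattiniFixersInner p G) (hΦ : frattini G ≠ ⊥)
    {κ : G →* Multiplicative (ZMod p)} {x z : G} (hκ : κ ≠ 1)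
    (hzc : z ∈ Subgroup.center G) (hzp : z ^ p = 1) (hz1 : z ≠ 1)
    (hx : ∀ g, x * g * x⁻¹ = g * z ^ (κ g).toAdd.val) (hxΦ : x ∉ frattini G)
    {t : G} (ht : t ∈ Subgroup.center G) : t ^ p ≠ x ^ p := by
  intro htx
  have hc := hI.center_le hG hΦ
  have htn : ∀ g, t⁻¹ * g = g * t⁻¹ := fun g =>
    (Subgroup.mem_center_iff.1 (inv_mem ht) g).symm
  have hκx : κ x = 1 := by
    have := hx x
    rw [mul_inv_cancel_right, left_eq_mul, pow_val_eq_one_iff hzp hz1] at this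
    exact this
  have hmem : x * t⁻¹ ∈ frattini G := by
    refine hI.mem_frattini_of_conj hG hp2 hκ (hc hzc) hzc hzp ?_ ?_ fun g => ?_
    · have : Commute x t⁻¹ := (htn x).symm
      rw [this.mul_pow, inv_pow, htx, mul_inv_cancel]
    · rw [map_mul, hκx, map_eq_one_of_mem_frattini κ (inv_mem (hc ht)), one_mul]
    · have hzn := Subgroup.mem_center_iff.1 (pow_mem hzc (κ g).toAdd.val) (x * t⁻¹)
      rw [mul_assoc, htn, ← mul_assoc, mul_inv_eq_iff_eq_mul.1 (hx g), mul_assoc, mul_assoc,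
        ← hzn, mul_assoc g]
  exact hxΦ (by simpa using mul_mem hmem (hc ht))

open scoped IsMulCommutative in
theorem FrattiniFixersInner.centralizer_le [Finite G] (hG : IsPGroup p G) (hp2 : p ≠ 2)
    (hI : FrattiniFixersInner p G) (hΦ : frattini G ≠ ⊥) :
    Subgroup.centralizer (frattini G : Set G) ≤ frattini G := by
  intro c hcC
  by_contra hcΦ
  have hc := hI.center_le hG hΦ
  obtain ⟨z, hz, hzc, hzp, hz1⟩ := hG.exists_mem_center_of_normal hΦ
  have hzκ : ∀ κ : G →* Multiplicative (ZMod p), κ z = 1 := fun κ =>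
    map_eq_one_of_mem_frattini κ hz
  obtain ⟨κ, hκ⟩ := hG.exists_hom_ne_one hcΦ
  obtain ⟨x, hxC, hx⟩ := hI.exists_centralizer_of_hom κ hz hzc hzp
  have hκx : κ x = 1 := by
    have := hx x
    rw [mul_inv_cancel_right, left_eq_mul, pow_val_eq_one_iff hzp hz1] at this
    exact this
  have hκ1 : κ ≠ 1 := fun h => hκ (by simp [h])
  have hxΦ : x ∉ frattini G := fun h => by
    have h1 := hx c
    rw [Subgroup.mem_centralizer_iff.1 hcC x h, mul_inv_cancel_right, left_eq_mul,
      pow_val_eq_one_iff hzp hz1] at h1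
    exact hκ h1
  obtain ⟨κ', hκ'⟩ := hG.exists_hom_ne_one hxΦ
  have hΩ : ∀ t ∈ Subgroup.center G, t ^ p = 1 → t ∈ Subgroup.zpowers z := by
    intro t ht htp
    obtain ⟨y, -, hy⟩ := hI.exists_centralizer_of_hom κ' (hc ht) ht htp
    have h1 := mul_inv_eq_iff_eq_mul.1 (hy x)
    have h2 := mul_inv_eq_iff_eq_mul.1 (hx y)
    have hcz := Subgroup.mem_center_iff.1 (pow_mem hzc (κ y).toAdd.val)
    have hct := Subgroup.mem_center_iff.1 (pow_mem ht (κ' x).toAdd.val)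
    have h3 : z ^ (κ y).toAdd.val * t ^ (κ' x).toAdd.val = 1 := by
      rw [mul_assoc, ← hct, ← mul_assoc, h2, mul_assoc y, ← hcz, ← mul_assoc, mul_assoc] at h1
      exact left_eq_mul.1 h1
    have h4 : t ^ (κ' x).toAdd.val ∈ Subgroup.zpowers z := by
      rw [eq_inv_of_mul_eq_one_right h3]
      exact inv_mem (pow_mem (Subgroup.mem_zpowers z) _)
    have h5 : t ^ ((κ' x).toAdd * (κ' x).toAdd⁻¹).val ∈ Subgroup.zpowers z := by
      rw [pow_val_mul htp, pow_mul]
      exact pow_mem h4 _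
    rwa [mul_inv_cancel₀ (fun h => hκ' h), ZMod.val_one, pow_one] at h5
  let P : Subgroup.center G →* Subgroup.center G := powMonoidHom p
  have hindex : Nat.card (Subgroup.center G ⧸ P.range) = p := by
    have h1 : P.ker = Subgroup.zpowers (⟨z, hzc⟩ : Subgroup.center G) := by
      ext t
      refine ⟨fun h => ?_, fun h => ?_⟩
      · obtain ⟨n, hn⟩ := hΩ t t.2 (by simpa [P, Subtype.ext_iff] using h)
        exact ⟨n, Subtype.ext (by simpa using hn)⟩
      · obtain ⟨n, rfl⟩ := h
        refine zpow_mem ?_ n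
        simpa [P, Subtype.ext_iff] using hzp
    have h2 : orderOf (⟨z, hzc⟩ : Subgroup.center G) = p :=
      orderOf_eq_prime (Subtype.ext hzp) fun h => hz1 (congrArg Subtype.val h)
    rw [← Subgroup.index_eq_card, CommGroup.index_range_powMonoidHom]
    change Nat.card P.ker = p
    rw [h1, Nat.card_zpowers, h2]
  have hmemP : ∀ t : Subgroup.center G, t ∈ P.range → ∃ s ∈ Subgroup.center G, s ^ p = (t : G) := by
    rintro _ ⟨s, rfl⟩
    exact ⟨s, s.2, rfl⟩
  obtain ⟨y, hyC, hy⟩ := hI.exists_centralizer_of_hom κ' hz hzc hzp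
  have hxp := pow_mem_center_of_conj hzp (hzκ κ) hx
  have hyp := pow_mem_center_of_conj hzp (hzκ κ') hy
  by_cases hxR : (⟨x ^ p, hxp⟩ : Subgroup.center G) ∈ P.range
  · obtain ⟨t, ht, htx⟩ := hmemP _ hxR
    exact hI.pow_ne_of_conj hG hp2 hΦ hκ1 hzc hzp hz1 hx hxΦ ht htx
  have hne : (QuotientGroup.mk ⟨x ^ p, hxp⟩ : Subgroup.center G ⧸ P.range) ≠ 1 := fun h =>
    hxR ((QuotientGroup.eq_one_iff _).1 h)
  obtain ⟨j, hj⟩ := mem_powers_of_prime_card hindex hne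
    (g' := (QuotientGroup.mk ⟨y ^ p, hyp⟩ : Subgroup.center G ⧸ P.range)⁻¹)
  have hR : (⟨x ^ p, hxp⟩ : Subgroup.center G) ^ j * ⟨y ^ p, hyp⟩ ∈ P.range := by
    rw [← QuotientGroup.eq_one_iff, QuotientGroup.mk_mul, QuotientGroup.mk_pow]
    simp only at hj
    rw [hj, inv_mul_cancel]
  obtain ⟨t, ht, htw⟩ := hmemP _ hR
  have hw : ∀ g, (x ^ j * y) * g * (x ^ j * y)⁻¹ = g * z ^ ((κ ^ j * κ') g).toAdd.val := by
    intro g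
    have h1 : (x ^ j * y) * g * (x ^ j * y)⁻¹ = x ^ j * (y * g * y⁻¹) * (x ^ j)⁻¹ := by group
    rw [h1, hy, conj_pow_eq hzp (hzκ κ) hx, map_mul, map_pow, hzκ, one_pow, mul_one,
      MonoidHom.mul_apply, mul_comm ((κ ^ j) g), toAdd_mul, pow_val_add hzp, mul_assoc]
  have hx1 : (κ ^ j * κ') x ≠ 1 := by
    rwa [MonoidHom.mul_apply, MonoidHom.pow_apply, hκx, one_pow, one_mul]
  refine hI.pow_ne_of_conj hG hp2 hΦ (fun h => hx1 (by simp [h])) hzc hzp hz1 hw (fun h => ?_) ht ?_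
  · have h1 := hw x
    rw [Subgroup.mem_centralizer_iff.1 hxC _ h, mul_inv_cancel_right, left_eq_mul,
      pow_val_eq_one_iff hzp hz1] at h1
    exact hx1 h1
  · have hcomm := mul_inv_eq_iff_eq_mul.1 (conj_pow_eq hzp (hzκ κ) hx j y)
    have hcc := Subgroup.mem_center_iff.1 (pow_mem hzc ((κ ^ j) y).toAdd.val)
    have hconj : y * x ^ j = x ^ j * y * (z ^ ((κ ^ j) y).toAdd.val)⁻¹ := by
      rw [hcomm, mul_assoc, mul_assoc, ← hcc, mul_assoc, inv_mul_cancel, mul_one]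
    rw [mul_pow_of_conj (inv_mem (pow_mem hzc _)) hconj]
    obtain ⟨m, hm⟩ : p ∣ p.choose 2 := (Fact.out : p.Prime).dvd_choose_self two_ne_zero
      (lt_of_le_of_ne (Fact.out : p.Prime).two_le hp2.symm)
    have hzp' : (z ^ ((κ ^ j) y).toAdd.val) ^ p = 1 := by
      rw [← pow_mul, mul_comm _ p, pow_mul, hzp, one_pow]
    rw [hm, pow_mul, inv_pow, hzp', inv_one, one_pow, mul_one, htw, ← pow_mul, mul_comm j p,
      pow_mul]
    rfl

end Centralizer

section CrossedHoms

variable {p : ℕ} [Fact p.Prime] {V : Type*} [AddCommGroup V] [Module (ZMod p) V]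

theorem sub_one_pow_eq_zero {A : Module.End (ZMod p) V} (hA : A ^ p = 1) : (A - 1) ^ p = 0 := by
  have h : ((Polynomial.X - 1) ^ p : Polynomial (ZMod p)) = Polynomial.X ^ p - 1 := by
    rw [sub_pow_char, one_pow]
  simpa [hA] using congrArg (Polynomial.aeval A) h

theorem geom_sum_eq_zero_of_finrank_lt [FiniteDimensional (ZMod p) V]
    (hV : Module.finrank (ZMod p) V < p) {A : Module.End (ZMod p) V} (hA : A ^ p = 1) :
    ∑ i ∈ Finset.range p, A ^ i = 0 := by
  have h : ∑ i ∈ Finset.range p, Polynomial.X ^ i =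
      ((Polynomial.X - 1) ^ (p - 1) : Polynomial (ZMod p)) := by
    have hX : (Polynomial.X - 1 : Polynomial (ZMod p)) ≠ 0 := Polynomial.X_sub_C_ne_zero 1
    refine mul_right_cancel₀ hX ?_
    rw [geom_sum_mul, ← pow_succ, Nat.sub_add_cancel (Fact.out : p.Prime).one_le, sub_pow_char,
      one_pow]
  have h1 : ∑ i ∈ Finset.range p, A ^ i = (A - 1) ^ (p - 1) := by
    simpa using congrArg (Polynomial.aeval A) h
  rw [h1, ← LinearMap.ker_eq_top, Module.End.ker_pow_eq_ker_pow_finrank_of_le (by omega),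
    ← Module.End.ker_pow_eq_ker_pow_finrank_of_le hV.le, LinearMap.ker_eq_top,
    sub_one_pow_eq_zero hA]

/-- Crossed homomorphisms from `Q` to a representation of `Q`. -/
def crossedHoms {Q : Type*} [Group Q] (ρ : Q →* Module.End (ZMod p) V) :
    Submodule (ZMod p) (Q → V) where
  carrier := {f | ∀ g h, f (g * h) = f g + ρ g (f h)}
  add_mem' {f f'} hf hf' g h := by
    simp only [Pi.add_apply, hf g h, hf' g h, map_add]
    abel
  zero_mem' g h := by simp
  smul_mem' c f hf g h := by simp [hf g h]

variable {Q : Type*} [CommGroup Q] {ρ : Q →* Module.End (ZMod p) V}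

theorem apply_one_of_mem_crossedHoms {f : Q → V} (hf : f ∈ crossedHoms ρ) : f 1 = 0 := by
  simpa using hf 1 1

/-- A crossed homomorphism on the kernel of `κ` extends to the whole group, with value `v` at a
generator `a` of a complement, as soon as `v` and `f` are compatible. -/
theorem exists_extension_crossedHom {κ : Q →* Multiplicative (ZMod p)} {a : Q}
    (hκa : κ a = Multiplicative.ofAdd 1) (hap : a ^ p = 1)
    (hnorm : ∑ i ∈ Finset.range p, ρ a ^ i = 0) {f : κ.ker → V}
    (hf : f ∈ crossedHoms (ρ.comp κ.ker.subtype)) {v : V}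
    (hfv : ∀ h : κ.ker, ρ a (f h) - f h = ρ h v - v) :
    ∃ F ∈ crossedHoms ρ, (∀ h : κ.ker, F h = f h) ∧ F a = v := by
  let N : ℕ → Module.End (ZMod p) V := fun n => ∑ i ∈ Finset.range n, ρ a ^ i
  have hN_add : ∀ m n, N (m + n) = N m + ρ a ^ m * N n := fun m n => by
    simp only [N, Finset.sum_range_add, Finset.mul_sum, pow_add]
  have hN_mod : ∀ n, N (n % p) = N n := fun n => by
    have hmul : ∀ k, N (p * k) = 0 := fun k => by
      induction k with
      | zero => simp [N]
      | succ k ih => rw [mul_add, hN_add, ih, mul_one, show N p = 0 from hnorm]; simp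
    conv_rhs => rw [← Nat.div_add_mod n p]
    rw [hN_add, hmul, zero_add, pow_mul, ← map_pow, hap, map_one, one_pow, one_mul]
  have hN_val : ∀ k l : ZMod p, N (k + l).val = N k.val + ρ a ^ k.val * N l.val := fun k l => by
    rw [ZMod.val_add, hN_mod, hN_add]
  have hgeom : ∀ n, ρ a ^ n - 1 = N n * (ρ a - 1) := fun n => (geom_sum_mul _ n).symm
  let e : Q → ℕ := fun q => (κ q).toAdd.val
  have hker : ∀ q, q * (a ^ e q)⁻¹ ∈ κ.ker := fun q => by
    rw [MonoidHom.mem_ker, map_mul, map_inv, map_pow, hκa, mul_inv_eq_one]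
    refine Multiplicative.toAdd.injective ?_
    simp [e]
  let π : Q → κ.ker := fun q => ⟨q * (a ^ e q)⁻¹, hker q⟩
  have hπ : ∀ q, q = π q * a ^ e q := fun q => by simp [π]
  have hπ_mul : ∀ q r, π (q * r) = π q * π r := fun q r => Subtype.ext <| by
    simp only [π, e, Subgroup.coe_mul, map_mul, toAdd_mul, pow_val_add hap, mul_inv]
    exact mul_mul_mul_comm _ _ _ _
  have hcomm : ∀ (q r : Q) x, ρ q (ρ r x) = ρ r (ρ q x) := fun q r x => by
    rw [← Module.End.mul_apply, ← map_mul, mul_comm, map_mul, Module.End.mul_apply]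
  have hcommN : ∀ (q : Q) n x, ρ q (N n x) = N n (ρ q x) := fun q n x => by
    simp only [N, LinearMap.sum_apply, map_sum, ← map_pow, hcomm q]
  have hfv' : ∀ (n : ℕ) (h : κ.ker), (ρ a ^ n) (f h) - f h = ρ h (N n v) - N n v := fun n h => by
    have := congrArg (N n) (hfv h)
    rw [map_sub, map_sub, ← hcommN h] at this
    rw [← this, ← map_sub]
    exact LinearMap.congr_fun (hgeom n) (f h)
  have he_ker : ∀ h : κ.ker, e h = 0 := fun h => by
    simp [e, MonoidHom.mem_ker.1 h.2]
  have hea : e a = 1 := by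
    simp only [e, hκa]
    exact ZMod.val_one p
  refine ⟨fun q => f (π q) + ρ (π q) (N (e q) v), fun q r => ?_, fun h => ?_, ?_⟩
  · have h1 : N (e (q * r)) = N (e q) + ρ a ^ e q * N (e r) := by
      simp only [e, map_mul, toAdd_mul, hN_val]
    have h2 : ρ q = ρ (π q) * ρ a ^ e q := by
      rw [← map_pow, ← map_mul, ← hπ]
    have h3 := hf (π q) (π r)
    simp only [MonoidHom.comp_apply, Subgroup.coe_subtype] at h3
    have h4 := congrArg (ρ (π q)) (sub_eq_sub_iff_add_eq_add.1 (hfv' (e q) (π r)))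
    rw [map_add, map_add] at h4
    simp only [hπ_mul, h3, h1, h2, Subgroup.coe_mul, map_mul, LinearMap.add_apply,
      Module.End.mul_apply, map_add]
    rw [← map_pow, hcomm (π r) (a ^ e q)]
    rw [← map_pow] at h4
    generalize ρ (π q) (ρ (a ^ e q) (f (π r))) = x1 at *
    rw [eq_sub_of_add_eq h4]
    abel
  · have h1 : π h = h := Subtype.ext (by simp [π, he_ker])
    simp [h1, he_ker, N]
  · have h1 : π a = 1 := Subtype.ext (by simp [π, hea])
    have h2 : f 1 = 0 := apply_one_of_mem_crossedHoms (ρ := ρ.comp κ.ker.subtype) hf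
    simp [h1, h2, hea, N]

/-- The principal crossed homomorphisms. -/
def principalCrossedHom {Q : Type*} [Group Q] (ρ : Q →* Module.End (ZMod p) V) :
    V →ₗ[ZMod p] crossedHoms ρ where
  toFun v := ⟨fun q => ρ q v - v, fun g h => by simp⟩
  map_add' v w := Subtype.ext <| funext fun q => by
    simp only [map_add, Submodule.coe_add, Pi.add_apply]
    abel
  map_smul' c v := Subtype.ext <| funext fun q => by simp [smul_sub]

@[simp]
theorem principalCrossedHom_apply {Q : Type*} [Group Q] (ρ : Q →* Module.End (ZMod p) V) (v : V)
    (q : Q) : (principalCrossedHom ρ v : Q → V) q = ρ q v - v := rfl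

theorem range_principalCrossedHom_ne_top [Finite V] {κ : Q →* Multiplicative (ZMod p)} {b : Q}
    (hκb : κ b = Multiplicative.ofAdd 1) (hbp : b ^ p = 1)
    (hnorm : ∑ i ∈ Finset.range p, ρ b ^ i = 0) {w : V} (hw : w ≠ 0) (hρw : ∀ q, ρ q w = w) :
    (principalCrossedHom ρ).range ≠ ⊤ := by
  let W : Submodule (ZMod p) V :=
    { carrier := {x | ∀ h ∈ κ.ker, ρ h x = x}
      add_mem' := fun hx hy h hh => by rw [map_add, hx h hh, hy h hh]
      zero_mem' := fun h _ => map_zero _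
      smul_mem' := fun c x hx h hh => by rw [map_smul, hx h hh] }
  have hW : ∀ x ∈ W, (ρ b - 1) x ∈ W := fun x hx h hh => by
    have : ρ h (ρ b x) = ρ b x := by
      rw [← Module.End.mul_apply, ← map_mul, mul_comm, map_mul, Module.End.mul_apply, hx h hh]
    simp [this, hx h hh]
  have hinj : ¬ Function.Injective ((ρ b - 1).restrict hW) := fun hinj => by
    have h0 : (⟨w, fun h _ => hρw h⟩ : W) = 0 := hinj <| Subtype.ext <| by simp [hρw b]
    exact hw (congrArg Subtype.val h0)
  rw [LinearMap.injective_iff_surjective] at hinj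
  obtain ⟨⟨v, hv⟩, hv'⟩ := not_forall.1 hinj
  obtain ⟨F, hF, hF0, hFb⟩ := exists_extension_crossedHom hκb hbp hnorm (f := 0)
    (Submodule.zero_mem _) (v := v) fun h => by simp [hv h h.2]
  intro htop
  obtain ⟨w', hw'⟩ : (⟨F, hF⟩ : crossedHoms ρ) ∈ (principalCrossedHom ρ).range := by
    rw [htop]
    trivial
  have hw'' : ∀ q, ρ q w' - w' = F q := fun q => congrFun (congrArg Subtype.val hw') q
  have hw'W : w' ∈ W := fun h hh => by
    rw [← sub_eq_zero, hw'']
    exact hF0 ⟨h, hh⟩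
  exact hv' ⟨⟨w', hw'W⟩, Subtype.ext <| by simpa [hFb] using hw'' b⟩

theorem LinearMap.range_coprod_neg_ne_top_of_pow_eq_zero {K M N : Type*} [Ring K]
    [AddCommGroup M] [AddCommGroup N] [Module K M] [Module K N] {T : Module.End K N} {n : ℕ}
    (hT : T ^ n = 0) {D : M →ₗ[K] N} (hD : D.range ≠ ⊤) (hTD : ∀ x ∈ D.range, T x ∈ D.range) :
    (T.coprod (-D)).range ≠ ⊤ := by
  rw [LinearMap.range_coprod, LinearMap.range_neg]
  intro h
  refine hD ?_
  have : ∀ k, (T ^ k).range ⊔ D.range = ⊤ := fun k => by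
    induction k with
    | zero => rw [pow_zero, Module.End.one_eq_id, LinearMap.range_id, top_sup_eq]
    | succ k ih =>
      rw [eq_top_iff, ← h]
      refine sup_le ?_ le_sup_right
      rintro _ ⟨y, rfl⟩
      obtain ⟨_, ⟨z, rfl⟩, d, hd, rfl⟩ := Submodule.mem_sup.1 (ih.ge (Submodule.mem_top (x := y)))
      rw [map_add]
      refine Submodule.add_mem_sup ⟨z, ?_⟩ (hTD d hd)
      rw [pow_succ', Module.End.mul_apply]
  simpa [hT] using this n

theorem card_lt_card_crossedHoms [Finite V] [Finite Q] (hQ : ∀ q : Q, q ^ p = 1)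
    (hnorm : ∀ q, ∑ i ∈ Finset.range p, ρ q ^ i = 0) {w : V} (hw : w ≠ 0)
    (hρw : ∀ q, ρ q w = w) {κ κ' : Q →* Multiplicative (ZMod p)} {a b : Q}
    (hκa : κ a = Multiplicative.ofAdd 1) (hκb : κ b = 1)
    (hκ'b : κ' b = Multiplicative.ofAdd 1) :
    Nat.card V < Nat.card (crossedHoms ρ) := by
  set σ := ρ.comp κ.ker.subtype with hσ
  have hD : (principalCrossedHom σ).range ≠ ⊤ :=
    range_principalCrossedHom_ne_top (κ := κ'.comp κ.ker.subtype) (b := ⟨b, hκb⟩) hκ'b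
      (Subtype.ext (hQ b)) (hnorm b) hw fun q => hρw q
  have hcomm : ∀ (q r : Q) x, ρ q (ρ r x) = ρ r (ρ q x) := fun q r x => by
    rw [← Module.End.mul_apply, ← map_mul, mul_comm, map_mul, Module.End.mul_apply]
  have hA : ∀ f ∈ crossedHoms σ, (ρ a).compLeft κ.ker f ∈ crossedHoms σ := fun f hf g h => by
    simp [hf g h, hσ, hcomm a]
  let A : Module.End (ZMod p) (crossedHoms σ) := ((ρ a).compLeft κ.ker).restrict hA
  have hA_apply : ∀ n (f : crossedHoms σ) h, ((A ^ n) f : κ.ker → V) h = (ρ a ^ n) (f.1 h) :=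
    fun n f h => by
      induction n with
      | zero => rfl
      | succ n ih =>
        rw [pow_succ', pow_succ', Module.End.mul_apply, Module.End.mul_apply, ← ih]
        rfl
  have hAp : A ^ p = 1 := LinearMap.ext fun f => Subtype.ext <| funext fun h => by
    rw [hA_apply, ← map_pow, hQ, map_one]
    rfl
  have hTD : ∀ x ∈ (principalCrossedHom σ).range, (A - 1) x ∈ (principalCrossedHom σ).range := by
    rintro _ ⟨x, rfl⟩
    refine ⟨ρ a x - x, Subtype.ext <| funext fun h => ?_⟩
    have h1 : (A (principalCrossedHom σ x) : κ.ker → V) h = ρ a (σ h x - x) := rfl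
    simp only [LinearMap.sub_apply, Module.End.one_apply, Submodule.coe_sub, Pi.sub_apply, h1,
      principalCrossedHom_apply, map_sub]
    rw [show σ h (ρ a x) = ρ a (σ h x) from hcomm h a x]
  have hS := LinearMap.range_coprod_neg_ne_top_of_pow_eq_zero (sub_one_pow_eq_zero hAp) hD hTD
  set S := (A - 1).coprod (-principalCrossedHom σ) with hS_def
  have hlt : Module.finrank (ZMod p) V < Module.finrank (ZMod p) S.ker := by
    have h1 := S.finrank_range_add_finrank_ker
    have h2 := Submodule.finrank_lt hS
    rw [Module.finrank_prod] at h1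
    omega
  have hext : ∀ x : S.ker, ∃ F : crossedHoms ρ, (∀ h : κ.ker, F.1 h = x.1.1.1 h) ∧
      F.1 a = x.1.2 := fun ⟨⟨⟨f, hf⟩, v⟩, hx⟩ => by
    obtain ⟨F, hF, hF1, hF2⟩ := exists_extension_crossedHom hκa (hQ a) (hnorm a) hf (v := v)
      fun h => by
        have h1 := congrFun (congrArg Subtype.val (LinearMap.mem_ker.1 hx)) h
        simp only [hS_def, LinearMap.coprod_apply, LinearMap.neg_apply, ← sub_eq_add_neg,
          Submodule.coe_sub, Pi.sub_apply] at h1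
        exact sub_eq_zero.1 h1
    exact ⟨⟨F, hF⟩, hF1, hF2⟩
  choose E hE1 hE2 using hext
  have hE : Function.Injective E := fun x y hxy => by
    refine Subtype.ext (Prod.ext (Subtype.ext (funext fun h => ?_)) ?_)
    · rw [← hE1, ← hE1, hxy]
    · rw [← hE2, ← hE2, hxy]
  refine lt_of_lt_of_le ?_ (Nat.card_le_card_of_injective E hE)
  rw [Module.natCard_eq_pow_finrank (K := ZMod p) (V := V),
    Module.natCard_eq_pow_finrank (K := ZMod p) (V := S.ker), Nat.card_zmod]
  exact Nat.pow_lt_pow_right (Fact.out : p.Prime).one_lt hlt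

end CrossedHoms

section Counting

variable {p : ℕ} [Fact p.Prime] {G : Type*} [Group G]

theorem CommGroup.card_ker_powMonoidHom_le {A : Type*} [CommGroup A] [Finite A] {n : ℕ}
    (hn : 0 < n) :
    Nat.card (powMonoidHom n : A →* A).ker ≤ n ^ Group.rank A := by
  rw [← CommGroup.index_range_powMonoidHom, Subgroup.index_eq_card]
  have hexp : ∀ x : A ⧸ (powMonoidHom n : A →* A).range, x ^ n = 1 := fun x => by
    obtain ⟨a, rfl⟩ := QuotientGroup.mk_surjective x
    rw [← QuotientGroup.mk_pow, QuotientGroup.eq_one_iff]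
    exact ⟨a, rfl⟩
  exact (Nat.le_of_dvd (pow_pos hn _) (card_dvd_exponent_pow_rank' _ hexp)).trans
    (Nat.pow_le_pow_right hn
      (Group.rank_le_of_surjective _ (QuotientGroup.mk'_surjective _)))

open scoped IsMulCommutative in
/-- The elements of order dividing `n` in the center of `H`, as a subgroup of the ambient group. -/
theorem Subgroup.exists_torsion_center [Finite G] (H : Subgroup G) {n : ℕ} (hn : 0 < n)
    {S : Finset H} (hS : Subgroup.closure (S : Set H) = Subgroup.center H) :
    ∃ V : Subgroup G, (∀ x, x ∈ V ↔ x ∈ H ∧ x ∈ Subgroup.centralizer (H : Set G) ∧ x ^ n = 1) ∧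
      Nat.card V ≤ n ^ S.card := by
  refine ⟨(((powMonoidHom n : Subgroup.center H →* _).ker.map
    (Subgroup.center H).subtype).map H.subtype), fun x => ⟨?_, ?_⟩, ?_⟩
  · rintro ⟨_, ⟨⟨y, hy⟩, hyn, rfl⟩, rfl⟩
    refine ⟨y.2, Subgroup.mem_centralizer_iff.2 fun h hh => ?_, ?_⟩
    · exact congrArg Subtype.val (Subgroup.mem_center_iff.1 hy ⟨h, hh⟩)
    · exact congrArg (fun z : H => (z : G)) (congrArg Subtype.val (MonoidHom.mem_ker.1 hyn))
  · rintro ⟨hxH, hxC, hxn⟩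
    refine ⟨⟨x, hxH⟩, ⟨⟨⟨x, hxH⟩, Subgroup.mem_center_iff.2 fun h => ?_⟩, ?_, rfl⟩, rfl⟩
    · exact Subtype.ext (Subgroup.mem_centralizer_iff.1 hxC h h.2)
    · exact MonoidHom.mem_ker.2 (Subtype.ext (Subtype.ext hxn))
  · rw [Subgroup.card_map_of_injective H.subtype_injective,
      Subgroup.card_map_of_injective (Subgroup.center H).subtype_injective]
    refine (CommGroup.card_ker_powMonoidHom_le hn).trans (Nat.pow_le_pow_right hn ?_)
    have hrank : ∀ K : Subgroup H, Subgroup.closure (S : Set H) = K → Group.rank K ≤ S.card := by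
      rintro _ rfl
      exact Subgroup.rank_closure_finset_le_card S
    exact hrank _ hS

theorem exists_map_pow_eq_ofAdd_one {κ : G →* Multiplicative (ZMod p)} {c : G}
    (hκ : κ c ≠ 1) : ∃ n : ℕ, κ (c ^ n) = Multiplicative.ofAdd 1 := by
  refine ⟨((κ c).toAdd⁻¹).val, Multiplicative.toAdd.injective ?_⟩
  have h0 : (κ c).toAdd ≠ 0 := fun h => hκ (Multiplicative.toAdd.injective h)
  rw [map_pow, toAdd_pow, toAdd_ofAdd, nsmul_eq_mul, ZMod.natCast_zmod_val, inv_mul_cancel₀ h0]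

theorem exists_mem_ker_notMem_frattini [Finite G]
    (hna : ¬ ∀ a b : G, a * b = b * a) (κ : G →* Multiplicative (ZMod p)) {c : G}
    (hκ : κ c ≠ 1) : ∃ b, κ b = 1 ∧ b ∉ frattini G := by
  by_contra! h
  refine hna ?_
  obtain ⟨n, hn⟩ := exists_map_pow_eq_ofAdd_one hκ
  have htop : Subgroup.zpowers (c ^ n) ⊔ frattini G = ⊤ := by
    refine eq_top_iff.2 fun g _ => ?_
    have hg : ((c ^ n) ^ (κ g).toAdd.val)⁻¹ * g ∈ frattini G := h _ <| by
      rw [map_mul, map_inv, map_pow, hn, inv_mul_eq_one]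
      exact Multiplicative.toAdd.injective (by simp)
    rw [← mul_inv_cancel_left ((c ^ n) ^ (κ g).toAdd.val) g]
    exact Subgroup.mul_mem_sup (Subgroup.pow_mem _ (Subgroup.mem_zpowers _) _) hg
  have htop' := frattini_nongenerating htop
  intro a b
  obtain ⟨i, rfl⟩ := Subgroup.mem_zpowers_iff.1 (htop'.ge (Subgroup.mem_top a))
  obtain ⟨j, rfl⟩ := Subgroup.mem_zpowers_iff.1 (htop'.ge (Subgroup.mem_top b))
  exact zpow_mul_comm _ _ _

theorem FrattiniFixersInner.card_conj_crossedHoms_le [Finite G] (hI : FrattiniFixersInner p G)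
    (hC : Subgroup.centralizer (frattini G : Set G) ≤ frattini G) {V : Subgroup G}
    (hV : ∀ x, x ∈ V ↔ x ∈ frattini G ∧ x ∈ Subgroup.centralizer (frattini G : Set G) ∧
      x ^ p = 1) :
    Nat.card {f : G → G // (∀ g, f g ∈ V) ∧ (∀ g h, f (g * h) = f g * (g * f h * g⁻¹)) ∧
      ∀ g ∈ frattini G, f g = 1} ≤ Nat.card V := by
  set Z := Subgroup.center G
  set C := {f : G → G // (∀ g, f g ∈ V) ∧ (∀ g h, f (g * h) = f g * (g * f h * g⁻¹)) ∧
      ∀ g ∈ frattini G, f g = 1}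
  let X : Set G := {x | x ∈ Subgroup.centralizer (frattini G : Set G) ∧ x ^ p ∈ Z}
  have hX : ∀ f : C, ∃ x ∈ X, ∀ g, x * g * x⁻¹ = f.1 g * g := fun ⟨f, hfV, hf, hfΦ⟩ => by
    have hconj : ∀ g, (g⁻¹ * f g * g) ^ p = 1 := fun g => by
      have := conj_pow (a := g⁻¹) (b := f g) (i := p)
      rw [inv_inv] at this
      rw [this, ((hV _).1 (hfV g)).2.2, mul_one, inv_mul_cancel]
    obtain ⟨x, hxC, hx⟩ := hI.exists_centralizer (δ := fun g => g⁻¹ * f g * g)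
      (fun g h => by rw [hf]; group)
      (fun g => by
        have := (inferInstance : (frattini G).Normal).conj_mem _ ((hV _).1 (hfV g)).1 g⁻¹
        rwa [inv_inv] at this)
      (fun g hg => by rw [hfΦ g hg]; group) hconj
    have hx' : ∀ g, x * g * x⁻¹ = f g * g := fun g => by rw [hx]; group
    refine ⟨x, ⟨hxC, Subgroup.mem_center_iff.2 fun g => ?_⟩, hx'⟩
    have hxf : ∀ g, x * f g = f g * x := fun g =>
      Subgroup.mem_centralizer_iff.1 ((hV _).1 (hfV g)).2.1 x (hC hxC)
    have hn : ∀ n, x ^ n * g * (x ^ n)⁻¹ = f g ^ n * g := fun n => by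
      induction n with
      | zero => simp
      | succ n ih =>
        have h1 : x ^ (n + 1) * g * (x ^ (n + 1))⁻¹ = x * (x ^ n * g * (x ^ n)⁻¹) * x⁻¹ := by
          rw [pow_succ']; group
        have h2 : x * f g ^ n = f g ^ n * x := (Commute.pow_right (hxf g) n).eq
        rw [h1, ih, ← mul_assoc, h2, mul_assoc, mul_assoc, ← mul_assoc x, hx', ← mul_assoc,
          ← pow_succ]
    have := hn p
    rw [((hV _).1 (hfV g)).2.2, one_mul, mul_inv_eq_iff_eq_mul] at this
    exact this.symm
  choose x hxX hx using hX
  have h1 : Nat.card (C × Z) ≤ Nat.card X := by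
    refine Nat.card_le_card_of_injective
      (fun y => ⟨x y.1 * y.2, Subgroup.mul_mem _ (hxX y.1).1 ?_, ?_⟩) ?_
    · exact Subgroup.center_le_centralizer _ y.2.2
    · have hcomm : Commute (x y.1) y.2 := Subgroup.mem_center_iff.1 y.2.2 _
      rw [hcomm.mul_pow]
      exact mul_mem (hxX y.1).2 (pow_mem y.2.2 p)
    · rintro ⟨f, z⟩ ⟨f', z'⟩ h
      have h2 : x f * z = x f' * z' := congrArg Subtype.val h
      have h3 : ∀ (f : C) (z : Z) g, (x f * z) * g * (x f * z)⁻¹ = f.1 g * g := fun f z g => by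
        rw [← hx, mul_inv_rev, mul_assoc (x f), ← Subgroup.mem_center_iff.1 z.2 g]
        group
      have h4 : f = f' := Subtype.ext <| funext fun g => by
        have := h3 f z g
        rw [h2, h3] at this
        exact (mul_right_cancel this).symm
      subst h4
      exact Prod.ext rfl (Subtype.ext (mul_left_cancel h2))
  have h2 : Nat.card X ≤ Nat.card (V × Z) := by
    let s : G → G := Function.invFunOn (fun x => x ^ p) X
    have hs : ∀ y ∈ X, s (y ^ p) ∈ X ∧ s (y ^ p) ^ p = y ^ p := fun y hy =>
      ⟨Function.invFunOn_mem ⟨y, hy, rfl⟩,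
        Function.invFunOn_eq (f := fun x => x ^ p) ⟨y, hy, rfl⟩⟩
    refine Nat.card_le_card_of_injective
      (fun y => (⟨y * (s (y ^ p))⁻¹, (hV _).2 ?_⟩, ⟨y ^ p, y.2.2⟩)) ?_
    · obtain ⟨hsX, hsp⟩ := hs y y.2
      have hm := Subgroup.mul_mem _ y.2.1 (Subgroup.inv_mem _ hsX.1)
      have hcomm : Commute (y : G) (s (y ^ p)) :=
        Subgroup.mem_centralizer_iff.1 hsX.1 y (hC y.2.1)
      refine ⟨hC hm, hm, ?_⟩
      rw [hcomm.inv_right.mul_pow, inv_pow, hsp, mul_inv_cancel]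
    · intro y y' h
      have h3 : (y : G) ^ p = y' ^ p := congrArg Subtype.val (congrArg Prod.snd h)
      have h4 : (y : G) * (s (y ^ p))⁻¹ = y' * (s (y' ^ p))⁻¹ :=
        congrArg Subtype.val (congrArg Prod.fst h)
      rw [h3] at h4
      exact Subtype.ext (mul_right_cancel h4)
  have h3 := h1.trans h2
  rw [Nat.card_prod, Nat.card_prod] at h3
  exact Nat.le_of_mul_le_mul_right h3 Nat.card_pos

end Counting

section Main

variable {p : ℕ} [Fact p.Prime] {G : Type*} [Group G]

/-- The linear action attached to an action on a commutative group of exponent `n`. -/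
def MonoidHom.toZModEnd (n : ℕ) {A : Type*} [CommGroup A] [Module (ZMod n) (Additive A)]
    (c : G →* MulAut A) : G →* Module.End (ZMod n) (Additive A) where
  toFun g := (MonoidHom.toAdditive (c g).toMonoidHom).toZModLinearMap n
  map_one' := LinearMap.ext fun x => by
    change Additive.ofMul (c 1 x.toMul) = x
    simp
  map_mul' g h := LinearMap.ext fun x => by
    change Additive.ofMul (c (g * h) x.toMul) = Additive.ofMul (c g (c h x.toMul))
    simp

theorem IsPGroup.card_lt_card_crossedHoms_of_action [Finite G] (hG : IsPGroup p G)
    (hna : ¬ ∀ a b : G, a * b = b * a) {A : Type*} [CommGroup A] [Finite A]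
    (hA : ∀ x : A, x ^ p = 1) (hcard : Nat.card A < p ^ p) (c : G →* MulAut A)
    (hc : ∀ g ∈ frattini G, c g = 1) {w : A} (hw : w ≠ 1) (hcw : ∀ g, c g w = w) :
    Nat.card A < Nat.card {f : G → A // (∀ g h, f (g * h) = f g * c g (f h)) ∧
      ∀ g ∈ frattini G, f g = 1} := by
  have : Module (ZMod p) (Additive A) := AddCommGroup.zmodModule fun x => hA x.toMul
  let _ : CommGroup (G ⧸ frattini G) := { QuotientGroup.Quotient.group (frattini G) with
    mul_comm := fun x y => by
      obtain ⟨g, rfl⟩ := QuotientGroup.mk_surjective x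
      obtain ⟨h, rfl⟩ := QuotientGroup.mk_surjective y
      change ((g * h : G) : G ⧸ frattini G) = ((h * g : G) : G ⧸ frattini G)
      refine QuotientGroup.eq.2 ?_
      have := hG.mul_mul_inv_mul_inv_mem_frattini h⁻¹ g⁻¹
      rwa [inv_inv, inv_inv, mul_assoc, ← mul_inv_rev] at this }
  have hQ : ∀ q : G ⧸ frattini G, q ^ p = 1 := fun q => by
    obtain ⟨g, rfl⟩ := QuotientGroup.mk_surjective q
    rw [← QuotientGroup.mk_pow, QuotientGroup.eq_one_iff]
    exact hG.pow_mem_frattini g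
  let ρ : G ⧸ frattini G →* Module.End (ZMod p) (Additive A) :=
    QuotientGroup.lift (frattini G) (MonoidHom.toZModEnd p c) fun g hg => LinearMap.ext fun x => by
      change Additive.ofMul (c g x.toMul) = x
      rw [hc g hg]
      rfl
  have hρ : ∀ (g : G) (x : Additive A), ρ g x = Additive.ofMul (c g x.toMul) := fun g x => rfl
  have hfin : Module.finrank (ZMod p) (Additive A) < p := by
    have h1 := Module.natCard_eq_pow_finrank (K := ZMod p) (V := Additive A)
    rw [Nat.card_zmod, Nat.card_congr Additive.toMul] at h1
    rw [h1] at hcard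
    exact (Nat.pow_lt_pow_iff_right (Fact.out : p.Prime).one_lt).1 hcard
  obtain ⟨d, hd⟩ : ∃ d, d ∉ frattini G := by
    by_contra! h
    have hbot : (⊥ : Subgroup G) = ⊤ := frattini_nongenerating <| by
      rw [bot_sup_eq]
      exact eq_top_iff.2 fun g _ => h g
    have h1 : ∀ g : G, g = 1 := fun g => Subgroup.mem_bot.1 (hbot.ge (Subgroup.mem_top g))
    exact hna fun a b => by rw [h1 a, h1 b]
  obtain ⟨κ, hκd⟩ := hG.exists_hom_ne_one hd
  obtain ⟨b, hκb, hb⟩ := exists_mem_ker_notMem_frattini hna κ hκd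
  obtain ⟨κ', hκ'b⟩ := hG.exists_hom_ne_one hb
  obtain ⟨m, hm⟩ := exists_map_pow_eq_ofAdd_one hκd
  obtain ⟨n, hn⟩ := exists_map_pow_eq_ofAdd_one hκ'b
  have hlt := card_lt_card_crossedHoms (ρ := ρ) hQ
    (fun q => geom_sum_eq_zero_of_finrank_lt hfin (by rw [← map_pow, hQ, map_one]))
    (w := Additive.ofMul w) (fun h => hw h)
    (fun q => by
      obtain ⟨g, rfl⟩ := QuotientGroup.mk_surjective q
      exact (hρ g _).trans (congrArg Additive.ofMul (hcw g)))
    (κ := QuotientGroup.lift _ κ fun g hg => map_eq_one_of_mem_frattini κ hg)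
    (κ' := QuotientGroup.lift _ κ' fun g hg => map_eq_one_of_mem_frattini κ' hg)
    (a := (d ^ m : G)) (b := (b ^ n : G)) hm
    ((map_pow κ b n).trans (by rw [hκb, one_pow])) hn
  rw [Nat.card_congr Additive.toMul] at hlt
  refine hlt.trans_le (Nat.card_le_card_of_injective (fun f => ⟨fun g => (f.1 g).toMul,
    fun g h => ?_, fun g hg => ?_⟩) ?_)
  · exact congrArg Additive.toMul (f.2 g h)
  · beta_reduce
    rw [(QuotientGroup.eq_one_iff g).2 hg, apply_one_of_mem_crossedHoms f.2]
    rfl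
  · refine fun f f' h => Subtype.ext (funext fun q => ?_)
    obtain ⟨g, rfl⟩ := QuotientGroup.mk_surjective q
    exact congrFun (congrArg Subtype.val h) g

open scoped IsMulCommutative in
theorem IsPGroup.card_lt_card_conj_crossedHoms [Finite G] (hG : IsPGroup p G)
    (hna : ¬ ∀ a b : G, a * b = b * a) {V : Subgroup G}
    (hV : ∀ x, x ∈ V ↔ x ∈ frattini G ∧ x ∈ Subgroup.centralizer (frattini G : Set G) ∧
      x ^ p = 1) (hcard : Nat.card V < p ^ p) {z : G} (hz : z ∈ frattini G)
    (hzc : z ∈ Subgroup.center G) (hzp : z ^ p = 1) (hz1 : z ≠ 1) :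
    Nat.card V < Nat.card {f : G → G // (∀ g, f g ∈ V) ∧
      (∀ g h, f (g * h) = f g * (g * f h * g⁻¹)) ∧ ∀ g ∈ frattini G, f g = 1} := by
  have hVΦ : ∀ x ∈ V, ∀ g ∈ frattini G, g * x = x * g := fun x hx g hg =>
    Subgroup.mem_centralizer_iff.1 ((hV x).1 hx).2.1 g hg
  have : V.Normal := ⟨fun x hx g => (hV _).2 ⟨
    (inferInstance : (frattini G).Normal).conj_mem _ ((hV x).1 hx).1 g,
    (inferInstance : (Subgroup.centralizer (frattini G : Set G)).Normal).conj_mem _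
      ((hV x).1 hx).2.1 g, by rw [conj_pow, ((hV x).1 hx).2.2, mul_one, mul_inv_cancel]⟩⟩
  have : IsMulCommutative V := IsMulCommutative.of_setLike_mul_comm fun x hx y hy =>
    hVΦ y hy x ((hV x).1 hx).1
  have hzV : z ∈ V := (hV z).2 ⟨hz, Subgroup.center_le_centralizer _ hzc, hzp⟩
  have hlt := hG.card_lt_card_crossedHoms_of_action hna (A := V)
    (fun x => Subtype.ext ((hV x).1 x.2).2.2) hcard MulAut.conjNormal
    (fun g hg => MulEquiv.ext fun x => Subtype.ext <|
      mul_inv_eq_iff_eq_mul.2 (hVΦ x x.2 g hg))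
    (w := ⟨z, hzV⟩) (fun h => hz1 (congrArg Subtype.val h))
    (fun g => Subtype.ext <| mul_inv_eq_iff_eq_mul.2 (Subgroup.mem_center_iff.1 hzc g))
  refine hlt.trans_le (Nat.card_le_card_of_injective (fun f => ⟨fun g => f.1 g,
    fun g => (f.1 g).2, fun g h => congrArg Subtype.val (f.2.1 g h),
    fun g hg => congrArg Subtype.val (f.2.2 g hg)⟩) ?_)
  exact fun f f' h => Subtype.ext <| funext fun g =>
    Subtype.ext (congrFun (congrArg Subtype.val h) g)

end Main

/-- Let `G` be a finite non-abelian `p`-group such that the center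
`Z(Φ(G))` of the Frattini subgroup can be generated by `p - 2` elements.  Then `G` has
a non-inner automorphism `φ` of order `p` fixing `Φ(G)` element-wise. -/
theorem stmt_11 (p : ℕ) [Fact p.Prime]
    (G : Type) [Group G] [Finite G] (hG : IsPGroup p G)
    (hna : ¬ ∀ a b : G, a * b = b * a)
    (hgen : ∃ S : Finset ↥(frattini G), S.card ≤ p - 2 ∧
      Subgroup.closure (S : Set ↥(frattini G)) = Subgroup.center ↥(frattini G)) :
    ∃ φ : MulAut G, orderOf φ = p ∧
      (¬ ∃ h : G, ∀ g : G, φ g = h * g * h⁻¹) ∧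
      ∀ g ∈ frattini G, φ g = g := by
  by_contra! hcon
  have hI : FrattiniFixersInner p G := fun φ hφ hΦ => by
    by_contra! h
    obtain ⟨g, hg, hne⟩ := hcon φ hφ h
    exact hne (hΦ g hg)
  have hΦ : frattini G ≠ ⊥ := fun hbot => hna fun a b => by
    have := hG.mul_mul_inv_mul_inv_mem_frattini a b
    rw [hbot, Subgroup.mem_bot, mul_inv_eq_one, mul_inv_eq_iff_eq_mul] at this
    exact this
  obtain ⟨z, hz, hzc, hzp, hz1⟩ := hG.exists_mem_center_of_normal hΦ
  obtain ⟨S, hScard, hS⟩ := hgen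
  have hp := (Fact.out : p.Prime)
  have hp2 : p ≠ 2 := by
    rintro rfl
    rw [Nat.le_zero, Finset.card_eq_zero] at hScard
    rw [hScard, Finset.coe_empty, Subgroup.closure_empty] at hS
    have : (⟨z, hz⟩ : frattini G) ∈ Subgroup.center (frattini G) :=
      Subgroup.mem_center_iff.2 fun g => Subtype.ext (Subgroup.mem_center_iff.1 hzc g)
    rw [← hS, Subgroup.mem_bot] at this
    exact hz1 (congrArg Subtype.val this)
  obtain ⟨V, hV, hVcard⟩ := (frattini G).exists_torsion_center hp.pos hS
  exact (hG.card_lt_card_conj_crossedHoms hna hV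
    (hVcard.trans_lt (Nat.pow_lt_pow_right hp.one_lt (by have := hp.pos; omega)))
    hz hzc hzp hz1).not_ge
    (hI.card_conj_crossedHoms_le (hI.centralizer_le hG hp2 hΦ) hV)
end

section
/- Let Q be a finite non-cyclic p-group, and let A be a nontrivial finite abelian p-group equipped with an action of Q by automorphisms, such that A can be generated by p−2 elements as an abelian group. Then A is not cohomologically trivial as a Q-module; equivalently (since Q is finite), there exist a subgroup S ≤ Q and an integer n ≥ 1 such that the group cohomology H^n(S, A) is nonzero. -/
open Subgroup in
theorem mul_pow_of_central {Q : Type*} [Group Q] {x y c : Q} (hc : ∀ z, Commute c z)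
    (h : y * x = x * y * c) (n : ℕ) : (x * y) ^ n = x ^ n * y ^ n * c ^ n.choose 2 := by
  have hy : ∀ n : ℕ, y ^ n * x = x * y ^ n * c ^ n := by
    intro n
    induction n with
    | zero => simp
    | succ n ih =>
      rw [pow_succ', mul_assoc, ih, ← mul_assoc, ← mul_assoc, h, mul_assoc x y c,
        pow_succ' c, (hc y).symm.eq, mul_assoc x (c * y), mul_assoc c y, (hc (y * y ^ n)).eq]
      simp only [mul_assoc]
  induction n with
  | zero => simp
  | succ n ih =>
    have h2 : (n + 1).choose 2 = n + n.choose 2 := by simp [Nat.choose_succ_succ' n 1]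
    rw [pow_succ, ih, h2, ((hc (x * y)).pow_left _).right_comm, mul_assoc (x ^ n),
      ← mul_assoc (y ^ n), hy, pow_succ x n, pow_succ y, pow_add, ← mul_assoc, ← mul_assoc,
      ((hc y).pow_left n).right_comm]
    simp only [mul_assoc]

theorem IsPGroup.normal_of_index_eq {p : ℕ} [Fact p.Prime] {Q : Type*} [Group Q] [Finite Q]
    (hQ : IsPGroup p Q) {M : Subgroup Q} (hM : M.index = p) : M.Normal := by
  obtain ⟨n, hn⟩ := IsPGroup.iff_card.1 hQ
  apply Subgroup.normal_of_index_eq_minFac_card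
  have : n ≠ 0 := by
    rintro rfl
    have h1 := M.index_dvd_card
    rw [hM, hn, pow_zero] at h1
    exact (Fact.out : p.Prime).one_lt.ne' (Nat.dvd_one.1 h1)
  rw [hM, hn, (Fact.out : p.Prime).pow_minFac this]

theorem IsPGroup.exists_subgroup_card_sq {p : ℕ} [Fact p.Prime] (hp2 : 2 < p) (N : ℕ) :
    ∀ (Q : Type) [Group Q] [Finite Q], IsPGroup p Q → ¬ IsCyclic Q → Nat.card Q = N →
    ∃ K : Subgroup Q, Nat.card K = p ^ 2 ∧ ∀ x ∈ K, x ^ p = 1 := by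
  have hp : p.Prime := Fact.out
  induction N using Nat.strong_induction_on with
  | _ N ih =>
  intro Q _ _ hQ hc hN
  by_cases hH : ∃ H : Subgroup Q, H ≠ ⊤ ∧ ¬ IsCyclic H
  · obtain ⟨H, hH, hHc⟩ := hH
    obtain ⟨K, hK, hK1⟩ := ih (Nat.card H) (hN ▸ lt_of_le_of_ne (Subgroup.card_le_card_group H)
      (fun h => hH (Subgroup.eq_top_of_card_eq H h))) H (hQ.to_subgroup H) hHc rfl
    refine ⟨K.map H.subtype, ?_, ?_⟩
    · rw [Subgroup.card_map_of_injective H.subtype_injective, hK]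
    · rintro _ ⟨x, hx, rfl⟩
      rw [← map_pow, hK1 x hx, map_one]
  push Not at hH
  obtain ⟨n, hn⟩ := IsPGroup.iff_card.1 hQ
  obtain ⟨m, rfl⟩ : ∃ m, n = m + 1 := by
    refine Nat.exists_eq_succ_of_ne_zero ?_
    rintro rfl
    have : Subsingleton Q := (Nat.card_eq_one_iff_unique.1 (by simpa using hn)).1
    exact hc inferInstance
  have key : ∀ x : Q, ∃ M : Subgroup Q, x ∈ M ∧ Nat.card M = p ^ m := by
    intro x
    obtain ⟨k, hk⟩ := IsPGroup.iff_card.1 (hQ.to_subgroup (Subgroup.zpowers x))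
    have hlt : k < m + 1 := by
      rw [← Nat.pow_lt_pow_iff_right hp.one_lt, ← hk, ← hn]
      refine lt_of_le_of_ne (Subgroup.card_le_card_group _) fun h => hc ?_
      have := Subgroup.eq_top_of_card_eq _ h
      exact ⟨x, fun y => (Subgroup.eq_top_iff' _).1 this y⟩
    obtain ⟨M, hM, hle⟩ := Sylow.exists_subgroup_card_pow_prime_le p
      (hn ▸ pow_dvd_pow p (Nat.le_succ m) : p ^ m ∣ Nat.card Q) _ hk (Nat.lt_succ_iff.1 hlt)
    exact ⟨M, hle (Subgroup.mem_zpowers x), hM⟩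
  have hidx : ∀ M : Subgroup Q, Nat.card M = p ^ m → M.index = p := by
    intro M hM
    have := M.card_mul_index
    rw [hM, hn, pow_succ] at this
    exact Nat.eq_of_mul_eq_mul_left (pow_pos hp.pos m) this
  have hne : ∀ M : Subgroup Q, Nat.card M = p ^ m → M ≠ ⊤ := by
    rintro _ hM rfl
    have := hidx _ hM
    rw [Subgroup.index_top] at this
    exact hp.one_lt.ne this
  have hpow : ∀ M : Subgroup Q, Nat.card M = p ^ m → ∀ x, x ^ p ∈ M := by
    intro M hM x
    have := hQ.normal_of_index_eq (hidx M hM)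
    have h := M.pow_index_mem x
    rwa [hidx M hM] at h
  have hcomm : ∀ M : Subgroup Q, Nat.card M = p ^ m → ∀ x y, (x * y)⁻¹ * (y * x) ∈ M := by
    intro M hM x y
    have := hQ.normal_of_index_eq (hidx M hM)
    have : IsCyclic (Q ⧸ M) := isCyclic_of_prime_card (p := p) (hidx M hM)
    rw [← QuotientGroup.eq]
    exact (IsCyclic.isMulCommutative (α := Q ⧸ M)).is_comm.comm (x : Q ⧸ M) y
  have habel : ∀ M : Subgroup Q, Nat.card M = p ^ m → ∀ x ∈ M, ∀ y ∈ M, Commute x y := by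
    intro M hM x hx y hy
    have := hH M (hne M hM)
    exact congrArg Subtype.val ((IsCyclic.isMulCommutative (α := M)).is_comm.comm ⟨x, hx⟩ ⟨y, hy⟩)
  obtain ⟨M₁, -, hM₁⟩ := key 1
  obtain ⟨x, hx⟩ : ∃ x, x ∉ M₁ := by
    by_contra! h
    exact hne M₁ hM₁ (Subgroup.eq_top_iff' M₁ |>.2 h)
  obtain ⟨M₂, hxM, hM₂⟩ := key x
  have hlt : M₁ ⊓ M₂ < M₂ := inf_le_right.lt_of_not_ge fun h => hx (h hxM).1
  have hlt' : M₁ < M₁ ⊔ M₂ := le_sup_left.lt_of_not_ge fun h => hx (h (Subgroup.mem_sup_right hxM))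
  have hsup : M₁ ⊔ M₂ = ⊤ := by
    by_contra hne
    have h1 := Subgroup.relIndex_mul_index hlt'.le
    rw [hidx M₁ hM₁] at h1
    rcases (Nat.dvd_prime hp).1 (Dvd.intro_left _ h1) with h2 | h2
    · exact hne (Subgroup.index_eq_one.1 h2)
    · rw [h2] at h1
      have := Nat.eq_of_mul_eq_mul_right hp.pos (h1.trans (one_mul p).symm)
      exact hlt'.not_ge (Subgroup.relIndex_eq_one.1 this)
  have hcen : ∀ c ∈ M₁ ⊓ M₂, ∀ z, Commute c z := by
    intro c hcc z
    have h : M₁ ⊔ M₂ ≤ Subgroup.centralizer {c} := by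
      refine sup_le ?_ ?_ <;> intro y hy <;> rw [Subgroup.mem_centralizer_singleton_iff]
      · exact (habel M₁ hM₁ c hcc.1 y hy).symm
      · exact (habel M₂ hM₂ c hcc.2 y hy).symm
    have := h (hsup ▸ Subgroup.mem_top z)
    rw [Subgroup.mem_centralizer_singleton_iff] at this
    exact this.symm
  let φ : Q →* Q := MonoidHom.mk' (fun x => x ^ p) (by
    intro x y
    have hcD : (x * y)⁻¹ * (y * x) ∈ M₁ ⊓ M₂ := ⟨hcomm M₁ hM₁ x y, hcomm M₂ hM₂ x y⟩
    have hyp : y ^ p ∈ M₁ ⊓ M₂ := ⟨hpow M₁ hM₁ y, hpow M₂ hM₂ y⟩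
    set c := (x * y)⁻¹ * (y * x) with hcdef
    have h1 : y * x = x * y * c := by rw [hcdef, mul_inv_cancel_left]
    have hcp : c ^ p = 1 := by
      have hconj : x⁻¹ * y * x = y * c := by rw [mul_assoc, h1]; group
      have h3 : (x⁻¹ * y * x) ^ p = x⁻¹ * y ^ p * x := by
        simpa using (conj_pow (a := x⁻¹) (b := y) (i := p))
      rw [hconj, ((hcen c hcD y).symm).mul_pow, mul_assoc, (hcen _ hyp x).eq,
        inv_mul_cancel_left] at h3
      exact mul_eq_left.1 h3
    obtain ⟨k, hk⟩ := hp.dvd_choose_self two_ne_zero hp2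
    rw [mul_pow_of_central (hcen c hcD) h1, hk, pow_mul, hcp, one_pow, mul_one])
  have hrange : φ.range ≤ M₁ ⊓ M₂ := by
    rintro _ ⟨y, rfl⟩
    exact ⟨hpow M₁ hM₁ y, hpow M₂ hM₂ y⟩
  obtain ⟨d, hd⟩ := IsPGroup.iff_card.1 (hQ.to_subgroup (M₁ ⊓ M₂))
  have hdm : d < m := by
    rw [← Nat.pow_lt_pow_iff_right hp.one_lt, ← hd, ← hM₂]
    exact Set.ncard_lt_ncard hlt (Set.toFinite _)
  obtain ⟨k, hk⟩ := IsPGroup.iff_card.1 (hQ.to_subgroup φ.ker)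
  have hcard : p ^ (m + 1) ≤ p ^ (k + d) := by
    have h1 := φ.ker.card_mul_index
    rw [Subgroup.index_ker, hk, hn] at h1
    rw [← h1, pow_add, ← hd]
    exact Nat.mul_le_mul_left _ (Subgroup.card_le_of_le hrange)
  rw [Nat.pow_le_pow_iff_right hp.one_lt] at hcard
  obtain ⟨K, hK⟩ := Sylow.exists_subgroup_card_pow_prime p
    (hk ▸ pow_dvd_pow p (by omega) : p ^ 2 ∣ Nat.card φ.ker)
  refine ⟨K.map φ.ker.subtype, ?_, ?_⟩
  · rw [Subgroup.card_map_of_injective φ.ker.subtype_injective, hK]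
  · rintro _ ⟨x, -, rfl⟩
    exact x.2

theorem IsPGroup.exists_commute_of_not_isCyclic {p : ℕ} [Fact p.Prime] (hp2 : 2 < p)
    {Q : Type} [Group Q] [Finite Q] (hQ : IsPGroup p Q) (hc : ¬ IsCyclic Q) :
    ∃ g h : Q, Commute g h ∧ orderOf g = p ∧ orderOf h = p ∧ h ∉ Subgroup.zpowers g := by
  have hp : p.Prime := Fact.out
  obtain ⟨K, hK, hK1⟩ := IsPGroup.exists_subgroup_card_sq hp2 _ Q hQ hc rfl
  have := IsPGroup.isMulCommutative_of_card_eq_prime_sq hK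
  obtain ⟨g, hgK, hg⟩ : ∃ g ∈ K, g ≠ 1 := by
    refine K.bot_or_exists_ne_one.resolve_left ?_
    rintro rfl
    rw [Subgroup.card_bot] at hK
    exact (Nat.one_lt_pow two_ne_zero hp.one_lt).ne hK
  have hgo : orderOf g = p := orderOf_eq_prime (hK1 g hgK) hg
  obtain ⟨h, hhK, hh⟩ : ∃ h ∈ K, h ∉ Subgroup.zpowers g := by
    by_contra! hle
    have h1 := Subgroup.card_le_of_le (show K ≤ Subgroup.zpowers g from hle)
    rw [hK, Nat.card_zpowers, hgo] at h1
    exact (Nat.pow_lt_pow_right hp.one_lt one_lt_two).not_ge (by simpa using h1)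
  refine ⟨g, h, ?_, hgo, orderOf_eq_prime (hK1 h hhK) ?_, hh⟩
  · exact congrArg Subtype.val (this.is_comm.comm (⟨g, hgK⟩ : K) ⟨h, hhK⟩)
  · rintro rfl
    exact hh (one_mem _)

open Polynomial in
theorem Polynomial.exists_geom_sum_one_add_X_eq {p : ℕ} (hp : p.Prime) :
    ∃ V : ℤ[X], ∑ i ∈ Finset.range p, (1 + X : ℤ[X]) ^ i = (p : ℤ[X]) * (1 + X * V) + X ^ (p - 1) := by
  obtain ⟨r, hr⟩ := exists_add_pow_prime_eq hp (X : ℤ[X]) 1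
  have h1 : ∑ i ∈ Finset.range p, (1 + X : ℤ[X]) ^ i = X ^ (p - 1) + (p : ℤ[X]) * r := by
    apply mul_right_cancel₀ (X_ne_zero (R := ℤ))
    have := geom_sum_mul (1 + X : ℤ[X]) p
    rw [add_sub_cancel_left] at this
    rw [this, add_comm, hr, add_mul, pow_sub_one_mul hp.ne_zero]
    ring
  have h2 : r.eval 0 = 1 := by
    have := congrArg (Polynomial.eval 0) h1
    simp [eval_finsetSum, Nat.sub_ne_zero_of_lt hp.one_lt, hp.ne_zero] at this
    exact this
  obtain ⟨V, hV⟩ : X ∣ r - 1 := by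
    rw [X_dvd_iff, coeff_zero_eq_eval_zero, eval_sub, h2, eval_one, sub_self]
  exact ⟨V, by rw [h1, ← hV]; ring⟩

theorem Module.End.pow_card_apply_eq_zero {K V : Type*} [Field K] [AddCommGroup V] [Module K V]
    {S : Finset V} (hS : Submodule.span K (S : Set V) = ⊤) (f : Module.End K V) {n : ℕ} {v : V}
    (hv : (f ^ n) v = 0) : (f ^ S.card) v = 0 := by
  have : FiniteDimensional K V := ⟨⟨S, hS⟩⟩
  have hrank : Module.finrank K V ≤ S.card := by
    rw [← finrank_top K V, ← hS]
    exact finrank_span_finset_le_card S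
  have h0 : v ∈ LinearMap.ker (f ^ Module.finrank K V) :=
    Module.End.ker_pow_le_ker_pow_finrank f n hv
  rw [← Nat.sub_add_cancel hrank, pow_add, Module.End.mul_apply, LinearMap.mem_ker.1 h0, map_zero]

theorem Module.End.pow_card_apply_eq_zero_of_closure {p : ℕ} [Fact p.Prime] {V : Type*}
    [AddCommGroup V] [Module (ZMod p) V] {S : Finset V}
    (hS : AddSubgroup.closure (S : Set V) = ⊤) (f : Module.End ℤ V) {n : ℕ} {v : V}
    (hv : (f ^ n) v = 0) : (f ^ S.card) v = 0 := by
  let F : Module.End (ZMod p) V := AddMonoidHom.toZModLinearMap p f.toAddMonoidHom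
  have hF : ∀ (k : ℕ) (v : V), (F ^ k) v = (f ^ k) v := by
    intro k
    induction k with
    | zero => intro v; rfl
    | succ k ih =>
      intro v
      rw [pow_succ, pow_succ]
      exact ih (f v)
  rw [← hF] at hv ⊢
  refine Module.End.pow_card_apply_eq_zero ?_ F hv
  rw [← Submodule.toAddSubgroup_inj, Submodule.top_toAddSubgroup, eq_top_iff, ← hS,
    AddSubgroup.closure_le]
  exact Submodule.subset_span

theorem Module.End.exists_pow_card_apply_eq_smul {p : ℕ} [Fact p.Prime] {A : Type*}
    [AddCommGroup A] {S : Finset A} (hS : AddSubgroup.closure (S : Set A) = ⊤)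
    (t : Module.End ℤ A) {n : ℕ} {a : A} (ha : ∃ b, (t ^ n) a = (p : ℤ) • b) {r : ℕ}
    (hr : S.card ≤ r) : ∃ b, (t ^ r) a = (p : ℤ) • b := by
  classical
  obtain ⟨P, hP⟩ : ∃ P : Submodule ℤ A, ∀ a, a ∈ P ↔ ∃ b, a = (p : ℤ) • b :=
    ⟨LinearMap.range (LinearMap.lsmul ℤ A (p : ℤ)), fun a => by
      simp [LinearMap.mem_range, eq_comm]⟩
  have hV : ∀ v : A ⧸ P, p • v = 0 := by
    intro v
    obtain ⟨a, rfl⟩ := P.mkQ_surjective v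
    rw [← map_nsmul]
    exact (Submodule.Quotient.mk_eq_zero P).2 ((hP _).2 ⟨a, (natCast_zsmul a p).symm⟩)
  let _ : Module (ZMod p) (A ⧸ P) := AddCommGroup.zmodModule hV
  have hle : P ≤ P.comap t := by
    intro x hx
    obtain ⟨b, rfl⟩ := (hP x).1 hx
    exact (hP _).2 ⟨t b, map_smul t _ b⟩
  have hf : ∀ (k : ℕ) (a : A), ((P.mapQ P t hle) ^ k) (P.mkQ a) = P.mkQ ((t ^ k) a) := by
    intro k a
    rw [← Submodule.mapQ_pow, Submodule.mkQ_apply, Submodule.mapQ_apply, Submodule.mkQ_apply]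
  have hspan : AddSubgroup.closure ((S.image P.mkQ : Finset (A ⧸ P)) : Set (A ⧸ P)) = ⊤ := by
    have := AddMonoidHom.map_closure (P.mkQ : A →+ A ⧸ P) (S : Set A)
    rw [hS, ← AddMonoidHom.range_eq_map, AddMonoidHom.range_eq_top.2 P.mkQ_surjective] at this
    rw [Finset.coe_image]
    exact this.symm
  have h1 := Module.End.pow_card_apply_eq_zero_of_closure (p := p) hspan (P.mapQ P t hle) (n := n)
    (v := P.mkQ a) (by rw [hf]; exact (Submodule.Quotient.mk_eq_zero P).2 ((hP _).2 ha))
  rw [← (hP _), ← Submodule.Quotient.mk_eq_zero, ← Submodule.mkQ_apply, ← hf,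
    ← Nat.sub_add_cancel ((Finset.card_image_le (s := S) (f := P.mkQ)).trans hr), pow_add, Module.End.mul_apply, h1,
    map_zero]

theorem groupCohomology.exists_eq_sub_of_subsingleton {G A : Type} [Group G] [AddCommGroup A]
    (ρ : Representation ℤ G A) (h : Subsingleton (groupCohomology (Rep.of ρ) 1)) (f : G → A)
    (hf : ∀ x y, f (x * y) = ρ x (f y) + f x) : ∃ a, ∀ x, ρ x a - a = f x := by
  have hc : f ∈ groupCohomology.cocycles₁ (Rep.of ρ) :=
    (groupCohomology.mem_cocycles₁_iff (A := Rep.of ρ) f).2 hf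
  obtain ⟨a, ha⟩ := (groupCohomology.H1π_eq_zero_iff (A := Rep.of ρ) ⟨f, hc⟩).1
    (Subsingleton.elim (α := groupCohomology (Rep.of ρ) 1) _ _)
  exact ⟨a, fun x => congrFun ha x⟩

theorem Representation.exists_fixed_sub_eq {p : ℕ} {Q A : Type} [Group Q]
    [AddCommGroup A] (ρ : Representation ℤ Q A)
    (hρ : ∀ S : Subgroup Q, Subsingleton (groupCohomology (Rep.of (ρ.comp S.subtype)) 1))
    {g h : Q} (hgh : Commute g h) (hp : 0 < p) (hh : h ^ p = 1)
    (hj : ∀ j : ℕ, h ^ j ∈ Subgroup.zpowers g → p ∣ j)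
    {b : A} (hgb : ρ g b = b) (hb : (∑ i ∈ Finset.range p, ρ h ^ i) b = 0) :
    ∃ a, ρ g a = a ∧ ρ h a - a = b := by
  let S : Subgroup Q :=
    { carrier := {x | ∃ (i : ℤ) (j : ℕ), x = g ^ i * h ^ j}
      one_mem' := ⟨0, 0, by simp⟩
      mul_mem' := by
        rintro _ _ ⟨i, j, rfl⟩ ⟨i', j', rfl⟩
        refine ⟨i + i', j + j', ?_⟩
        rw [zpow_add, pow_add]
        exact ((hgh.zpow_left i').pow_right j).symm.mul_mul_mul_comm _ _
      inv_mem' := by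
        rintro _ ⟨i, j, rfl⟩
        refine ⟨-i, p * j - j, ?_⟩
        have h1 : h ^ (p * j - j) = (h ^ j)⁻¹ := by
          rw [eq_inv_iff_mul_eq_one, ← pow_add, Nat.sub_add_cancel (Nat.le_mul_of_pos_left j hp),
            pow_mul, hh, one_pow]
        rw [h1, mul_inv_rev, zpow_neg]
        exact ((hgh.zpow_left i).pow_right j).inv_inv.symm.eq }
  let s : ℕ → A := fun j => ∑ i ∈ Finset.range j, (ρ h ^ i) b
  have hs : ∀ j k, s (j + k) = (ρ h ^ j) (s k) + s j := by
    intro j k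
    simp only [s, Finset.sum_range_add, map_sum, pow_add, Module.End.mul_apply]
    exact add_comm _ _
  have hsp : ∀ k, s (p * k) = 0 := by
    intro k
    induction k with
    | zero => simp [s]
    | succ k ih =>
      have : s p = 0 := by rw [← hb, LinearMap.sum_apply]
      rw [Nat.mul_succ, hs, ih, this, map_zero, add_zero]
  have hcomm : ∀ j : ℕ, Commute (ρ g) (ρ h ^ j) := fun j =>
    Commute.pow_right (by rw [Commute, SemiconjBy, ← map_mul, hgh.eq, map_mul]) j
  have hgs : ∀ j, ρ g (s j) = s j := by
    intro j
    simp only [s, map_sum]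
    refine Finset.sum_congr rfl fun i _ => ?_
    rw [← Module.End.mul_apply, (hcomm i).eq, Module.End.mul_apply, hgb]
  have hgs' : ∀ (i : ℤ) j, ρ (g ^ i) (s j) = s j := by
    intro i j
    have hg' : ρ g⁻¹ (s j) = s j := by
      nth_rw 1 [← hgs j]
      rw [← Module.End.mul_apply, ← map_mul, inv_mul_cancel, map_one, Module.End.one_apply]
    induction i using Int.induction_on with
    | zero => simp
    | succ i ih => rw [zpow_add_one, map_mul, Module.End.mul_apply, hgs, ih]
    | pred i ih => rw [zpow_sub_one, map_mul, Module.End.mul_apply, hg', ih]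
  have hle : ∀ (i i' : ℤ) (j j' : ℕ), j ≤ j' → g ^ i * h ^ j = g ^ i' * h ^ j' → s j = s j' := by
    intro i i' j j' hjj heq
    obtain ⟨d, rfl⟩ := Nat.exists_eq_add_of_le hjj
    obtain ⟨k, rfl⟩ : p ∣ d := by
      refine hj d ⟨-i' + i, ?_⟩
      rw [add_comm j, pow_add, ← mul_assoc] at heq
      change g ^ (-i' + i) = h ^ d
      rw [zpow_add, mul_right_cancel heq, zpow_neg, inv_mul_cancel_left]
    rw [hs, hsp, map_zero, zero_add]
  have hwd : ∀ (i i' : ℤ) (j j' : ℕ), g ^ i * h ^ j = g ^ i' * h ^ j' → s j = s j' := by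
    intro i i' j j' heq
    rcases le_total j j' with hjj | hjj
    · exact hle i i' j j' hjj heq
    · exact (hle i' i j' j hjj heq.symm).symm
  choose I J hIJ using fun x : S => x.2
  have hsJ : ∀ (x : S) (i : ℤ) (j : ℕ), (x : Q) = g ^ i * h ^ j → s (J x) = s j :=
    fun x i j hx => hwd (I x) i (J x) j ((hIJ x).symm.trans hx)
  obtain ⟨a, ha⟩ := groupCohomology.exists_eq_sub_of_subsingleton (ρ.comp S.subtype) (hρ S)
    (fun x => s (J x)) (by
      intro x y
      have hxy : ((x * y : S) : Q) = g ^ (I x + I y) * h ^ (J x + J y) := by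
        rw [Subgroup.coe_mul, hIJ x, hIJ y, zpow_add, pow_add]
        exact ((hgh.zpow_left (I y)).pow_right (J x)).symm.mul_mul_mul_comm _ _
      rw [hsJ _ _ _ hxy, hs]
      congr 1
      change _ = ρ x (s (J y))
      rw [hIJ x, ((hgh.zpow_left (I x)).pow_right (J x)).eq, map_mul, Module.End.mul_apply, hgs',
        map_pow])
  refine ⟨a, ?_, ?_⟩
  · have h1 := ha ⟨g, 1, 0, by simp⟩
    rw [hsJ _ 1 0 (by simp)] at h1
    simpa [s, sub_eq_zero] using h1
  · have h1 := ha ⟨h, 0, 1, by simp⟩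
    rw [hsJ _ 0 1 (by simp)] at h1
    simpa [s] using h1

theorem Module.End.exists_pow_eq_pow_smul {p : ℕ} {A : Type*} [AddCommGroup A]
    {t : Module.End ℤ A} {r : ℕ} (h : ∀ a, ∃ b, (t ^ r) a = (p : ℤ) • b) (k : ℕ) (a : A) :
    ∃ b, (t ^ (r * k)) a = (p ^ k : ℤ) • b := by
  induction k with
  | zero => exact ⟨a, by simp⟩
  | succ k ih =>
    obtain ⟨b, hb⟩ := ih
    obtain ⟨c, hc⟩ := h b
    refine ⟨c, ?_⟩
    rw [Nat.mul_succ, add_comm, pow_add, Module.End.mul_apply, hb, map_smul, hc, smul_smul,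
      pow_succ]

theorem Module.End.ker_eq_range_of_exact {A : Type*} [AddCommGroup A] [Finite A]
    {t N : Module.End ℤ A} (htN : t * N = 0) (hNt : N * t = 0)
    (h : ∀ b, N b = 0 → ∃ a, t a = b) {a : A} (ha : t a = 0) : ∃ b, N b = a := by
  have h1 : N.toAddMonoidHom.ker = t.toAddMonoidHom.range := by
    ext b
    refine ⟨fun hb => h b hb, ?_⟩
    rintro ⟨a, rfl⟩
    exact LinearMap.congr_fun hNt a
  have h2 : N.toAddMonoidHom.range ≤ t.toAddMonoidHom.ker := by
    rintro _ ⟨b, rfl⟩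
    exact LinearMap.congr_fun htN b
  have h3 := N.toAddMonoidHom.ker.card_mul_index
  have h4 := t.toAddMonoidHom.ker.card_mul_index
  rw [AddSubgroup.index_ker] at h3 h4
  rw [h1, ← h4, mul_comm] at h3
  have h5 := Nat.eq_of_mul_eq_mul_right Nat.card_pos h3
  have h6 := AddSubgroup.eq_of_le_of_card_ge h2 h5.ge
  have ha' : a ∈ t.toAddMonoidHom.ker := ha
  rw [← h6] at ha'
  exact ha'

open Polynomial in
theorem Module.End.sub_one_apply_eq_zero_iff {p : ℕ} [Fact p.Prime] (hp2 : 2 < p) {A : Type*}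
    [AddCommGroup A] [Finite A] {k : ℕ} (hk : ∀ a : A, (p ^ k : ℤ) • a = 0)
    {S : Finset A} (hS : AddSubgroup.closure (S : Set A) = ⊤) (hcard : S.card ≤ p - 2)
    {G : Module.End ℤ A} (hG : G ^ p = 1)
    (hex : ∀ b, (∑ i ∈ Finset.range p, G ^ i) b = 0 → ∃ a, G a - a = b) :
    (G - 1) ^ ((p - 2) * k) = 0 ∧ ∀ a, G a = a ↔ ∃ b, a = (p : ℤ) • b := by
  have hp : p.Prime := Fact.out
  set N := ∑ i ∈ Finset.range p, G ^ i with hN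
  set t := G - 1 with ht
  have htN : t * N = 0 := by rw [ht, hN, mul_geom_sum, hG, sub_self]
  have hNt : N * t = 0 := by rw [ht, hN, geom_sum_mul, hG, sub_self]
  obtain ⟨V, hV⟩ := Polynomial.exists_geom_sum_one_add_X_eq hp
  have hNV : N = (p : Module.End ℤ A) * (1 + t * aeval t V) + t ^ (p - 1) := by
    have := congrArg (aeval t) hV
    simpa [map_sum, ht, ← hN] using this
  set v := aeval t V
  have hNa : ∀ a, N a = (p : ℤ) • (a + t (v a)) + (t ^ (p - 1)) a := by
    intro a
    rw [hNV]
    simp [Module.End.mul_apply]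
  have htp : ∀ a, ∃ b, (t ^ p) a = (p : ℤ) • b := by
    intro a
    have h1 := congrArg t (hNa a)
    rw [← Module.End.mul_apply, htN, LinearMap.zero_apply, map_add,
      ← Module.End.mul_apply t (t ^ (p - 1)), mul_pow_sub_one hp.ne_zero, map_smul] at h1
    exact ⟨-t (a + t (v a)), by rw [smul_neg]; exact (neg_eq_of_add_eq_zero_right h1.symm).symm⟩
  have htr : ∀ a, ∃ b, (t ^ (p - 2)) a = (p : ℤ) • b := fun a =>
    Module.End.exists_pow_card_apply_eq_smul hS t (htp a) hcard
  have hnil : t ^ ((p - 2) * k) = 0 := by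
    ext a
    obtain ⟨b, hb⟩ := Module.End.exists_pow_eq_pow_smul htr k a
    rw [hb, hk, LinearMap.zero_apply]
  have hNc : ∀ a, ∃ c, N a = (p : ℤ) • a + t ((p : ℤ) • c) := by
    intro a
    obtain ⟨c, hc⟩ := htr a
    refine ⟨v a + c, ?_⟩
    rw [hNa, show p - 1 = 1 + (p - 2) by omega, pow_add, Module.End.mul_apply, hc, pow_one]
    simp only [smul_add, map_add, map_smul, add_assoc]
  have hnak : ∀ (n : ℕ) (a : A), ∃ b c, (p : ℤ) • a = N b + (t ^ n) ((p : ℤ) • c) := by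
    intro n
    induction n with
    | zero => intro a; exact ⟨0, a, by simp⟩
    | succ n ih =>
      intro a
      obtain ⟨b, c, hbc⟩ := ih a
      obtain ⟨d, hd⟩ := hNc c
      have hcomm : Commute (t ^ n) N := Commute.pow_left (htN.trans hNt.symm) n
      refine ⟨b + (t ^ n) c, -d, ?_⟩
      rw [hbc, ← sub_eq_iff_eq_add.2 hd, map_sub, map_add, ← Module.End.mul_apply (t ^ n) N,
        hcomm.eq, Module.End.mul_apply, pow_succ, Module.End.mul_apply, smul_neg, map_neg, map_neg]
      abel
  refine ⟨hnil, fun a => ⟨fun ha => ?_, ?_⟩⟩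
  · obtain ⟨b, rfl⟩ := Module.End.ker_eq_range_of_exact htN hNt hex
      (show t a = 0 from sub_eq_zero.2 ha)
    obtain ⟨c, hc⟩ := hNc b
    exact ⟨b + t c, by rw [hc, map_smul, smul_add]⟩
  · rintro ⟨a, rfl⟩
    obtain ⟨b, c, hbc⟩ := hnak ((p - 2) * k) a
    rw [hbc, hnil, LinearMap.zero_apply, add_zero]
    have : t (N b) = 0 := LinearMap.congr_fun htN b
    exact sub_eq_zero.1 this

theorem exists_forall_pow_smul_eq_zero {p : ℕ} {A : Type*} [AddCommGroup A] [Finite A]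
    (hA : ∀ a : A, ∃ k : ℕ, (p ^ k : ℤ) • a = 0) : ∃ k : ℕ, ∀ a : A, (p ^ k : ℤ) • a = 0 := by
  cases nonempty_fintype A
  choose k hk using hA
  refine ⟨∑ a, k a, fun a => ?_⟩
  obtain ⟨d, hd⟩ := Nat.exists_eq_add_of_le
    (Finset.single_le_sum (f := k) (fun _ _ => Nat.zero_le _) (Finset.mem_univ a))
  rw [hd, add_comm, pow_add, mul_smul, hk, smul_zero]

theorem Representation.subsingleton_of_subsingleton_H1 {p : ℕ} [Fact p.Prime] (hp2 : 2 < p)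
    {Q A : Type} [Group Q] [AddCommGroup A] [Finite A]
    (hA : ∀ a : A, ∃ k : ℕ, (p ^ k : ℤ) • a = 0) (ρ : Representation ℤ Q A)
    (hρ : ∀ S : Subgroup Q, Subsingleton (groupCohomology (Rep.of (ρ.comp S.subtype)) 1))
    {S : Finset A} (hS : AddSubgroup.closure (S : Set A) = ⊤) (hcard : S.card ≤ p - 2)
    {g h : Q} (hgh : Commute g h) (hg : orderOf g = p) (hh : orderOf h = p)
    (hhg : h ∉ Subgroup.zpowers g) : Subsingleton A := by
  have hp : p.Prime := Fact.out
  obtain ⟨k, hk⟩ := exists_forall_pow_smul_eq_zero hA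
  have key : ∀ x : Q, orderOf x = p → ((ρ x - 1) ^ ((p - 2) * k) = 0 ∧
      ∀ a, ρ x a = a ↔ ∃ b, a = (p : ℤ) • b) := by
    intro x hx
    refine Module.End.sub_one_apply_eq_zero_iff hp2 hk hS hcard ?_ fun b hb => ?_
    · rw [← map_pow, ← hx, pow_orderOf_eq_one, map_one]
    · obtain ⟨a, -, ha⟩ := ρ.exists_fixed_sub_eq hρ (Commute.one_left x) hp.pos
        (hx ▸ pow_orderOf_eq_one x) (fun j hj => by
          rw [Subgroup.zpowers_one_eq_bot, Subgroup.mem_bot] at hj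
          exact hx ▸ orderOf_dvd_of_pow_eq_one hj) (by simp) hb
      exact ⟨a, ha⟩
  have hdvd : ∀ j : ℕ, h ^ j ∈ Subgroup.zpowers g → p ∣ j := by
    intro j hj
    by_contra hpj
    refine hhg ?_
    have hcop : (orderOf h).Coprime j := hh ▸ (hp.coprime_iff_not_dvd.2 hpj)
    obtain ⟨m, hm⟩ := exists_pow_eq_self_of_coprime hcop.symm
    exact hm ▸ pow_mem hj m
  have hsq : ∀ b : A, (p : ℤ) • (p : ℤ) • b = 0 → (p : ℤ) • b = 0 := by
    intro b hb
    have hhb : ∀ i : ℕ, (ρ h ^ i) ((p : ℤ) • b) = (p : ℤ) • b := by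
      intro i
      induction i with
      | zero => rfl
      | succ i ih => rw [pow_succ, Module.End.mul_apply, ((key h hh).2 _).2 ⟨b, rfl⟩, ih]
    obtain ⟨a, hga, hha⟩ := ρ.exists_fixed_sub_eq hρ hgh hp.pos (hh ▸ pow_orderOf_eq_one h) hdvd
      (((key g hg).2 _).2 ⟨b, rfl⟩) (by
        rw [LinearMap.sum_apply, Finset.sum_congr rfl fun i _ => hhb i]
        simpa using hb)
    rw [← hha, ((key h hh).2 a).2 (((key g hg).2 a).1 hga), sub_self]
  have hpow : ∀ (n : ℕ) (a : A), (p ^ n : ℤ) • (p : ℤ) • a = 0 → (p : ℤ) • a = 0 := by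
    intro n
    induction n with
    | zero => intro a ha; simpa using ha
    | succ n ih =>
      intro a ha
      rw [pow_succ, mul_smul] at ha
      exact hsq a (ih _ ha)
  have hinj : Function.Injective (ρ g - 1 : Module.End ℤ A) := by
    rw [injective_iff_map_eq_zero]
    intro a ha
    obtain ⟨b, rfl⟩ := ((key g hg).2 a).1 (sub_eq_zero.1 ha)
    exact hpow k b (hk _)
  have hinj' := hinj.iterate ((p - 2) * k)
  rw [← Module.End.coe_pow, (key g hg).1] at hinj'
  exact ⟨fun a b => hinj' rfl⟩


/-- Let `Q` be a finite non-cyclic `p`-group and `A ≠ 0` a finite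
abelian `p`-group on which `Q` acts by automorphisms (a `ℤQ`-module, given here by a
representation `ρ : Q →* (A →ₗ[ℤ] A)`).  If `A` can be generated by `p - 2` elements
as an abelian group, then `A` is not cohomologically trivial: there are a subgroup
`S ≤ Q` and an integer `n ≥ 1` with `H^n(S, A) ≠ 0`. -/
theorem stmt_12 (p : ℕ) [Fact p.Prime]
    (Q : Type) [Group Q] [Finite Q] (hQp : IsPGroup p Q) (hQc : ¬ IsCyclic Q)
    (A : Type) [AddCommGroup A] [Module ℤ A] [Finite A] [Nontrivial A]
    (hAp : ∀ a : A, ∃ k : ℕ, (p ^ k : ℤ) • a = 0)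
    (ρ : Representation ℤ Q A)
    (hgen : ∃ S : Finset A, S.card ≤ p - 2 ∧ AddSubgroup.closure (S : Set A) = ⊤) :
    ∃ (S : Subgroup Q) (n : ℕ), 1 ≤ n ∧
      Nontrivial (groupCohomology (Rep.of (ρ.comp S.subtype)) n) := by
  rename_i instA _ _
  obtain rfl : instA = AddCommGroup.toIntModule A := Subsingleton.elim _ _
  obtain ⟨S, hcard, hS⟩ := hgen
  by_contra! hρ
  have hp2 : 2 < p := by
    by_contra hle
    have h0 : S = ∅ := Finset.card_eq_zero.1 (by omega)
    rw [h0, Finset.coe_empty, AddSubgroup.closure_empty] at hS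
    exact bot_ne_top hS
  obtain ⟨g, h, hgh, hg, hh, hhg⟩ := hQp.exists_commute_of_not_isCyclic hp2 hQc
  have := ρ.subsingleton_of_subsingleton_H1 hp2 hAp
    (fun S => hρ S 1 le_rfl) hS hcard hgh hg hh hhg
  exact not_subsingleton A this
end

section
/- Let n ≥ 1 and write n = l(p−1)p^{m−1} + r with 0 < r ≤ (p−1)p^{m−1}. Then, as abelian groups, 𝔒_m/𝔓^{n} ≅ (ℤ/p^{l+1}ℤ)^{r} ⊕ (ℤ/p^{l}ℤ)^{(p−1)p^{m−1}−r}. -/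
open Polynomial

/-- Let `S` be an `R`-algebra with basis `1, x, …, x^(d-1)`
where `x^d` and `p` divide each other.  If `r ≤ d` then `p^l * x^r` divides `y` iff the
first `r` coordinates of `y` are divisible by `p^(l+1)` and the others by `p^l`. -/
lemma pow_mul_pow_dvd_iff_repr {R S : Type*} [CommRing R] [CommRing S] [Algebra R S]
    (p : R) {d : ℕ} (b : Module.Basis (Fin d) R S) (x : S) (hb : ∀ i, b i = x ^ (i : ℕ))
    (h₁ : x ^ d ∣ algebraMap R S p) (h₂ : algebraMap R S p ∣ x ^ d)
    (l : ℕ) {r : ℕ} (hrd : r ≤ d) (y : S) :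
    algebraMap R S p ^ l * x ^ r ∣ y ↔
      ∀ i : Fin d, p ^ (if (i : ℕ) < r then l + 1 else l) ∣ b.repr y i := by
  constructor
  · have key : ∀ z : S, ∀ i : Fin d, (i : ℕ) < r → p ∣ b.repr (x ^ r * z) i := by
      intro z i hi
      rw [← b.sum_repr z, Finset.mul_sum, map_sum, Finsupp.finsetSum_apply]
      refine Finset.dvd_sum fun j _ => ?_
      rw [mul_smul_comm, map_smul, Finsupp.smul_apply, smul_eq_mul, hb, ← pow_add]
      refine Dvd.dvd.mul_left ?_ _
      rcases lt_or_ge (r + (j : ℕ)) d with h | h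
      · have : x ^ (r + (j : ℕ)) = b ⟨r + j, h⟩ := (hb ⟨r + j, h⟩).symm
        rw [this, b.repr_self, Finsupp.single_eq_of_ne]
        · exact dvd_zero _
        · rintro rfl
          simp at hi
      · obtain ⟨w, hw⟩ := h₂.trans (pow_dvd_pow x h)
        rw [hw, ← Algebra.smul_def, map_smul, Finsupp.smul_apply, smul_eq_mul]
        exact dvd_mul_right _ _
    rintro ⟨z, rfl⟩ i
    rw [mul_assoc, ← map_pow, ← Algebra.smul_def, map_smul, Finsupp.smul_apply, smul_eq_mul]
    split_ifs with hi
    · rw [pow_succ]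
      exact mul_dvd_mul_left _ (key z i hi)
    · exact dvd_mul_right _ _
  · intro h
    rw [← b.sum_repr y]
    refine Finset.dvd_sum fun i _ => ?_
    rw [Algebra.smul_def, hb]
    have hi := map_dvd (algebraMap R S) (h i)
    rw [map_pow] at hi
    split_ifs at hi with hir
    · refine Dvd.dvd.mul_right (dvd_trans ?_ hi) _
      rw [pow_succ]
      exact mul_dvd_mul_left _ ((pow_dvd_pow x hrd).trans h₁)
    · exact mul_dvd_mul hi (pow_dvd_pow x (not_lt.mp hir))

/-- If `x ^ d = -p * (1 + x * k)` then `x ^ d` divides `p`. -/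
lemma pow_dvd_of_pow_add_mul_eq_zero {S : Type*} [CommRing S] {x p k : S} {d : ℕ}
    (h : x ^ d + p * (1 + x * k) = 0) : x ^ d ∣ p := by
  have h₁ : 1 + x * k ∣ 1 - (-(x * k)) ^ d := by
    simpa using sub_dvd_pow_sub_pow (1 : S) (-(x * k)) d
  obtain ⟨w, hw⟩ := h₁
  refine ⟨p * (-k) ^ d - w, ?_⟩
  have h₂ : (-(x * k)) ^ d = x ^ d * (-k) ^ d := by rw [← mul_pow]; ring
  rw [h₂] at hw
  linear_combination p * hw + w * h

lemma exists_cyclotomic_prime_pow_comp_X_add_one_eq (p : ℕ) [hp : Fact p.Prime] {m : ℕ}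
    (hm : 1 ≤ m) (R : Type*) [CommRing R] :
    ∃ k : R[X], (cyclotomic (p ^ m) R).comp (X + 1) =
      X ^ ((p - 1) * p ^ (m - 1)) + C (p : R) * (1 + X * k) := by
  obtain ⟨m, rfl⟩ : ∃ k, m = k + 1 := ⟨m - 1, by omega⟩
  suffices h : ∃ k : ℤ[X], (cyclotomic (p ^ (m + 1)) ℤ).comp (X + 1) =
      X ^ ((p - 1) * p ^ m) + C (p : ℤ) * (1 + X * k) by
    obtain ⟨k, hk⟩ := h
    refine ⟨k.map (Int.castRingHom R), ?_⟩
    have := congrArg (Polynomial.map (Int.castRingHom R)) hk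
    simpa [Polynomial.map_comp] using this
  set f := (cyclotomic (p ^ (m + 1)) ℤ).comp (X + 1) with hf
  have hmon : f.Monic := by
    exact (cyclotomic.monic (p ^ (m + 1)) ℤ).comp_X_add_C 1
  have hdeg : f.natDegree = (p - 1) * p ^ m := by
    have : f.natDegree = (cyclotomic (p ^ (m + 1)) ℤ).natDegree := by
      rw [hf, ← C_1, natDegree_comp, natDegree_X_add_C, mul_one]
    rw [this, natDegree_cyclotomic, Nat.totient_prime_pow_succ hp.out, mul_comm]
  have hd : 0 < (p - 1) * p ^ m :=
    Nat.mul_pos (Nat.sub_pos_of_lt hp.out.one_lt) (pow_pos hp.out.pos _)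
  have hE := cyclotomic_prime_pow_comp_X_add_one_isEisensteinAt p m
  have hdvd : C (p : ℤ) ∣ f - X ^ ((p - 1) * p ^ m) := by
    rw [C_dvd_iff_dvd_coeff]
    intro i
    rw [coeff_sub, coeff_X_pow]
    rcases lt_trichotomy i ((p - 1) * p ^ m) with h | h | h
    · rw [if_neg h.ne, sub_zero, ← Ideal.mem_span_singleton]
      exact hE.mem (hdeg ▸ h)
    · rw [if_pos h, h, ← hdeg, hmon.coeff_natDegree, sub_self]
      exact dvd_zero _
    · rw [if_neg h.ne', coeff_eq_zero_of_natDegree_lt (hdeg ▸ h), sub_zero]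
      exact dvd_zero _
  obtain ⟨h, hh⟩ := hdvd
  have h0 : h.coeff 0 = 1 := by
    have := congrArg (fun q => q.coeff 0) hh
    simp only [coeff_sub, coeff_X_pow, if_neg hd.ne, coeff_C_mul, sub_zero] at this
    have hf0 : f.coeff 0 = p := by
      rw [coeff_zero_eq_eval_zero, hf, eval_comp]
      simp [eval_one_cyclotomic_prime_pow]
    rw [hf0] at this
    exact (mul_left_cancel₀ (Nat.cast_ne_zero.mpr hp.out.ne_zero) (by rw [← this, mul_one]))
  refine ⟨h.divX, ?_⟩
  have := divX_mul_X_add h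
  rw [h0, C_1] at this
  rw [← sub_eq_iff_eq_add', hh]
  conv_lhs => rw [← this]
  ring

/-- Reduction of coordinates modulo prime powers presents the quotient by `p^l * x^r`. -/
lemma nonempty_quotient_addEquiv (p : ℕ) [Fact p.Prime] {S : Type*} [CommRing S]
    [Algebra ℤ_[p] S] {d : ℕ} (b : Module.Basis (Fin d) ℤ_[p] S) (x : S)
    (hb : ∀ i, b i = x ^ (i : ℕ))
    (h₁ : x ^ d ∣ (p : S)) (h₂ : (p : S) ∣ x ^ d) (l : ℕ) {r : ℕ} (hrd : r ≤ d) :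
    Nonempty ((S ⧸ Ideal.span {x} ^ (l * d + r)) ≃+
      ((Fin r → ZMod (p ^ (l + 1))) × (Fin (d - r) → ZMod (p ^ l)))) := by
  let e₁ : Fin r → Fin d := Fin.castLE hrd
  let e₂ : Fin (d - r) → Fin d := fun i => ⟨r + i, by omega⟩
  let φ : S →+ (Fin r → ZMod (p ^ (l + 1))) × (Fin (d - r) → ZMod (p ^ l)) :=
    { toFun := fun y => (fun i => PadicInt.toZModPow (l + 1) (b.repr y (e₁ i)),
        fun i => PadicInt.toZModPow l (b.repr y (e₂ i)))
      map_zero' := by ext <;> simp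
      map_add' := fun y z => by ext <;> simp }
  have hφ : Function.Surjective φ := by
    rintro ⟨u, v⟩
    choose u' hu' using fun i => ZMod.ringHom_surjective (PadicInt.toZModPow (p := p) (l + 1)) (u i)
    choose v' hv' using fun i => ZMod.ringHom_surjective (PadicInt.toZModPow (p := p) l) (v i)
    let c : Fin d → ℤ_[p] := fun i =>
      if h : (i : ℕ) < r then u' ⟨i, h⟩ else v' ⟨i - r, by omega⟩
    have hc : ∀ i, b.repr (b.equivFun.symm c) i = c i := fun i =>
      congrFun (b.equivFun.apply_symm_apply c) i
    refine ⟨b.equivFun.symm c, Prod.ext (funext fun i => ?_) (funext fun i => ?_)⟩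
    · change PadicInt.toZModPow (l + 1) (b.repr (b.equivFun.symm c) (e₁ i)) = u i
      rw [hc, ← hu']
      simp [c, e₁]
    · change PadicInt.toZModPow l (b.repr (b.equivFun.symm c) (e₂ i)) = v i
      rw [hc, ← hv']
      simp [c, e₂]
  have hdvd : ∀ (k : ℕ) (a : ℤ_[p]), PadicInt.toZModPow k a = 0 ↔ (p : ℤ_[p]) ^ k ∣ a := by
    intro k a
    rw [← RingHom.mem_ker, PadicInt.ker_toZModPow, Ideal.mem_span_singleton]
  have hker : φ.ker = (Ideal.span {x} ^ (l * d + r)).toAddSubgroup := by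
    ext y
    have hx : x ^ (l * d + r) ∣ y ↔ algebraMap ℤ_[p] S p ^ l * x ^ r ∣ y := by
      rw [map_natCast, pow_add, mul_comm l d, pow_mul]
      exact ⟨(mul_dvd_mul_right (pow_dvd_pow_of_dvd h₂ l) _).trans,
        (mul_dvd_mul_right (pow_dvd_pow_of_dvd h₁ l) _).trans⟩
    rw [Submodule.mem_toAddSubgroup, Ideal.span_singleton_pow, Ideal.mem_span_singleton, hx,
      pow_mul_pow_dvd_iff_repr (p : ℤ_[p]) b x hb (by simpa) (by simpa) l hrd,
      AddMonoidHom.mem_ker]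
    simp only [φ, AddMonoidHom.coe_mk, ZeroHom.coe_mk, Prod.mk_eq_zero, funext_iff,
      Pi.zero_apply, hdvd]
    constructor
    · rintro ⟨hu, hv⟩ i
      split_ifs with hi
      · exact hu ⟨i, hi⟩
      · convert hv ⟨i - r, by omega⟩
        simp only [e₂, Fin.ext_iff]
        omega
    · intro h
      refine ⟨fun i => ?_, fun i => ?_⟩
      · simpa [e₁] using h (e₁ i)
      · simpa [e₂] using h (e₂ i)
  exact ⟨(QuotientAddGroup.quotientAddEquivOfEq hker.symm).trans
    (QuotientAddGroup.quotientKerEquivOfSurjective φ hφ)⟩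

/-- Let `p` be a prime, `m ≥ 1`, `g_m(X) = Φ_{p^m}(X+1) ∈ ℤ_p[X]`
(the `p^m`-th cyclotomic polynomial composed with `X+1`), and
`𝔒_m = ℤ_p[X]/(g_m)`, a discrete valuation ring whose maximal ideal `𝔓` is generated by
the image of `X`, with `p𝔒_m = 𝔓^((p-1)p^(m-1))`.  If `n = l(p-1)p^(m-1) + r` with
`0 < r ≤ (p-1)p^(m-1)`, then as abelian groups
`𝔒_m/𝔓^n ≅ (ℤ/p^(l+1)ℤ)^r ⊕ (ℤ/p^lℤ)^((p-1)p^(m-1) - r)`. -/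
theorem stmt_17 (p : ℕ) [Fact p.Prime] (m : ℕ) (hm : 1 ≤ m)
    (g : ℤ_[p][X]) (hg : g = (Polynomial.cyclotomic (p ^ m) ℤ_[p]).comp (X + 1))
    (n l r : ℕ) (hn : n = l * ((p - 1) * p ^ (m - 1)) + r) (hr0 : 0 < r)
    (hrb : r ≤ (p - 1) * p ^ (m - 1)) :
    Nonempty (((ℤ_[p][X] ⧸ Ideal.span {g}) ⧸
        (Ideal.span {Ideal.Quotient.mk (Ideal.span {g}) X}) ^ n) ≃+
      ((Fin r → ZMod (p ^ (l + 1))) ×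
        (Fin ((p - 1) * p ^ (m - 1) - r) → ZMod (p ^ l)))) := by

  obtain ⟨k, hk⟩ := exists_cyclotomic_prime_pow_comp_X_add_one_eq p hm ℤ_[p]
  rw [← hg] at hk
  have hmon : g.Monic := by
    rw [hg]
    simpa using (cyclotomic.monic (p ^ m) ℤ_[p]).comp_X_add_C 1
  have hdeg : g.natDegree = (p - 1) * p ^ (m - 1) := by
    rw [hg, ← C_1, natDegree_comp, natDegree_X_add_C, mul_one, natDegree_cyclotomic,
      Nat.totient_prime_pow Fact.out hm, mul_comm]
  have hroot : AdjoinRoot.root g ^ ((p - 1) * p ^ (m - 1)) +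
      (p : AdjoinRoot g) * (1 + AdjoinRoot.root g * AdjoinRoot.mk g k) = 0 := by
    have := congrArg (AdjoinRoot.mk g) hk
    rw [AdjoinRoot.mk_self] at this
    simpa using this.symm
  subst hn
  refine nonempty_quotient_addEquiv p (S := AdjoinRoot g)
    ((AdjoinRoot.powerBasis' hmon).basis.reindex (finCongr hdeg)) (AdjoinRoot.root g) (fun i => ?_)
    (pow_dvd_of_pow_add_mul_eq_zero hroot) ?_ l hrb
  · simp [PowerBasis.coe_basis]
    rfl
  · exact ⟨-(1 + AdjoinRoot.root g * AdjoinRoot.mk g k), by linear_combination hroot⟩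
end
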